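/- arXiv:0711.2413 — 3 statements merged into one kernel-verified Lean document; each statement's English description precedes it below -/
import Mathlib

section
/- Let Φ : S_2 → S_2 be a map such that for all A, B ∈ S_2, A is adjacent to B if and only if Φ(A) is adjacent to Φ(B). Then there exist c ∈ {−1, 1}, an invertible matrix R ∈ M_2(ℝ), and S ∈ S_2 such that Φ(A) = c·R·A·Rᵀ + S for all A ∈ S_2. -/
open Matrix

abbrev M2 := Matrix (Fin 2) (Fin 2) ℝ
abbrev V2 := Fin 2 → ℝ

lemma v2_ext {x y : V2} (h0 : x 0 = y 0) (h1 : x 1 = y 1) : x = y := by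
  ext i; fin_cases i <;> assumption

lemma m2_ext {x y : M2} (h0 : x 0 0 = y 0 0) (h1 : x 0 1 = y 0 1) (h2 : x 1 0 = y 1 0)
    (h3 : x 1 1 = y 1 1) : x = y := by
  ext i j; fin_cases i <;> fin_cases j <;> assumption

lemma v2_ne {x : V2} (h : x ≠ 0) : x 0 ≠ 0 ∨ x 1 ≠ 0 := by
  by_contra hc
  push Not at hc
  exact h (v2_ext hc.1 hc.2)

lemma v2_sq {x : V2} (h : x ≠ 0) : 0 < x 0 ^ 2 + x 1 ^ 2 := by
  rcases v2_ne h with h | h <;> positivity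

lemma mv0 (A : M2) (x : V2) : (A *ᵥ x) 0 = A 0 0 * x 0 + A 0 1 * x 1 := by
  simp [mulVec, dotProduct, Fin.sum_univ_two]
lemma mv1 (A : M2) (x : V2) : (A *ᵥ x) 1 = A 1 0 * x 0 + A 1 1 * x 1 := by
  simp [mulVec, dotProduct, Fin.sum_univ_two]

lemma mv_eq {A : M2} {x y : V2} : A *ᵥ x = y ↔
    A 0 0 * x 0 + A 0 1 * x 1 = y 0 ∧ A 1 0 * x 0 + A 1 1 * x 1 = y 1 := by
  constructor
  · rintro rfl; exact ⟨(mv0 A x).symm, (mv1 A x).symm⟩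
  · rintro ⟨h0, h1⟩; exact v2_ext (by rw [mv0, h0]) (by rw [mv1, h1])

lemma sym01 {A : M2} (h : A.IsSymm) : A 1 0 = A 0 1 := h.apply 0 1

lemma sym_of {A : M2} (h : A 1 0 = A 0 1) : A.IsSymm := by
  apply m2_ext <;> simp [transpose_apply, h]

lemma mv_inj {A : M2} (h : A.det ≠ 0) {x : V2} (hx : A *ᵥ x = 0) : x = 0 :=
  Matrix.eq_zero_of_mulVec_eq_zero h hx

lemma mv_ne {A : M2} (h : A.det ≠ 0) {x : V2} (hx : x ≠ 0) : A *ᵥ x ≠ 0 :=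
  fun h' => hx (mv_inj h h')

lemma rank_one_iff (A : M2) : A.rank = 1 ↔ A ≠ 0 ∧ A.det = 0 := by
  have hle : A.rank ≤ 2 := by simpa using A.rank_le_width
  have h0 : A.rank = 0 ↔ A = 0 := by
    constructor
    · intro h
      rw [Matrix.rank, Submodule.finrank_eq_zero, LinearMap.range_eq_bot] at h
      have h' : ∀ x, A *ᵥ x = 0 := fun x => by
        have := congrArg (fun f => f x) h
        simpa using this
      exact Matrix.ext_of_mulVec_single (fun i => by rw [h' , Matrix.zero_mulVec])
    · rintro rfl; simp
  have h2 : A.rank = 2 ↔ A.det ≠ 0 := by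
    constructor
    · intro h
      have : IsUnit A := by
        rw [← Matrix.mulVec_surjective_iff_isUnit]
        have hr : LinearMap.range A.mulVecLin = ⊤ := by
          apply Submodule.eq_top_of_finrank_eq
          rw [Matrix.rank] at h
          simpa using h
        exact LinearMap.range_eq_top.1 hr
      exact ((Matrix.isUnit_iff_isUnit_det A).1 this).ne_zero
    · intro h
      have := Matrix.rank_of_isUnit A ((Matrix.isUnit_iff_isUnit_det A).2 (isUnit_iff_ne_zero.2 h))
      simpa using this
  constructor
  · intro h
    refine ⟨fun hA => ?_, ?_⟩
    · have := h0.2 hA; omega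
    · by_contra hd
      have := h2.2 hd; omega
  · rintro ⟨hA, hd⟩
    have a1 : A.rank ≠ 0 := fun h => hA (h0.1 h)
    have a2 : A.rank ≠ 2 := fun h => h2.1 h hd
    omega

lemma null_lem {K : M2} (hK : K.IsSymm) (hd : K.det = 0) {x : V2}
    (hq : x 0 * (K *ᵥ x) 0 + x 1 * (K *ᵥ x) 1 = 0) : K *ᵥ x = 0 := by
  have hs := sym01 hK
  rw [det_fin_two] at hd
  rw [mv0, mv1] at hq
  rw [mv_eq]
  simp only [hs, Pi.zero_apply] at *
  set a := K 0 0
  set b := K 0 1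
  set c := K 1 1
  set p := x 0
  set q := x 1
  have h1 : (a * p + b * q) ^ 2 = 0 := by linear_combination a * hq - q^2 * hd
  have h2 : (b * p + c * q) ^ 2 = 0 := by linear_combination c * hq - p^2 * hd
  exact ⟨by simpa using h1, by simpa using h2⟩

lemma null_lem2 {K M : M2} (hK : K.IsSymm) (hM : M.IsSymm) {x : V2} (hx : x ≠ 0)
    (hMx : M *ᵥ x = 0) (hM0 : M ≠ 0) (hd : K.det = 0) (hd2 : (K - M).det = 0) :
    K *ᵥ x = 0 := by
  apply null_lem hK hd
  have hs := sym01 hK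
  have ht := sym01 hM
  have hxx := v2_sq hx
  rw [det_fin_two] at hd hd2
  rw [mv_eq] at hMx
  rw [mv0, mv1]
  have hne : M 0 0 ≠ 0 ∨ M 0 1 ≠ 0 ∨ M 1 1 ≠ 0 := by
    by_contra hc
    push Not at hc
    exact hM0 (m2_ext (by simp [hc]) (by simp [hc]) (by simp [ht, hc]) (by simp [hc]))
  simp only [hs, ht, Pi.zero_apply, Matrix.sub_apply] at *
  obtain ⟨h1, h2⟩ := hMx
  set a := K 0 0
  set b := K 0 1
  set c := K 1 1
  set p := x 0
  set q := x 1
  set a' := M 0 0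
  set b' := M 0 1
  set c' := M 1 1
  have key : a * c' + c * a' - 2 * b * b' = 0 := by
    linear_combination -hd2 + hd + (by
      rcases v2_ne hx with h | h
      · have : p * (a' * c' - b'^2) = 0 := by linear_combination c' * h1 - b' * h2
        exact (mul_eq_zero.1 this).resolve_left h
      · have : q * (a' * c' - b'^2) = 0 := by linear_combination a' * h2 - b' * h1
        exact (mul_eq_zero.1 this).resolve_left h : a' * c' - b' ^ 2 = 0)
  -- M = m (q,-p)(q,-p)^T
  have e1 : (p^2+q^2)^2 * a' = (a'+c') * (p^2+q^2) * q^2 := by grind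
  have e2 : (p^2+q^2)^2 * c' = (a'+c') * (p^2+q^2) * p^2 := by grind
  have e3 : (p^2+q^2)^2 * b' = - (a'+c') * (p^2+q^2) * (p * q) := by grind
  have hm : a' + c' ≠ 0 := by
    intro h
    rw [h] at e1 e2 e3
    have := hxx.ne'
    have h3 : (p^2+q^2)^2 ≠ 0 := by positivity
    have e1' : a' = 0 := by simpa [h3] using e1
    have e2' : c' = 0 := by simpa [h3] using e2
    have e3' : b' = 0 := by simpa [h3] using e3
    tauto
  have : (a'+c') * (p^2+q^2) * (p * (a * p + b * q) + q * (b * p + c * q)) = 0 := by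
    linear_combination (p^2+q^2)^2 * key - a * e2 - c * e1 + 2 * b * e3
  have h3 : (a'+c') * (p^2+q^2) ≠ 0 := mul_ne_zero hm hxx.ne'
  exact (mul_eq_zero.1 this).resolve_left h3

/-- existence of a symmetric matrix through two compatible points -/
lemma exists_two {x y u v : V2} (hi : x 0 * u 1 - x 1 * u 0 ≠ 0)
    (hc : x 0 * v 0 + x 1 * v 1 = y 0 * u 0 + y 1 * u 1) :
    ∃ A : M2, A.IsSymm ∧ A *ᵥ x = y ∧ A *ᵥ u = v := by
  set d := x 0 * u 1 - x 1 * u 0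
  refine ⟨!![(y 0 * u 1 - v 0 * x 1) / d, (v 0 * x 0 - y 0 * u 0) / d;
             (v 0 * x 0 - y 0 * u 0) / d, (v 1 * x 0 - y 1 * u 0) / d], sym_of (by simp), ?_, ?_⟩
  · rw [mv_eq]; simp; constructor <;> field_simp <;> grind
  · rw [mv_eq]; simp; constructor <;> field_simp <;> grind

def NN (x : V2) : M2 := !![x 1 ^ 2, - (x 0 * x 1); - (x 0 * x 1), x 0 ^ 2]

lemma NN_symm (x : V2) : (NN x).IsSymm := sym_of (by simp [NN])
lemma NN_mv (x : V2) : NN x *ᵥ x = 0 := by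
  rw [mv_eq]; simp [NN]; constructor <;> ring
lemma NN_ne {x : V2} (hx : x ≠ 0) : NN x ≠ 0 := by
  intro h
  have h0 := congrFun (congrFun h 0) 0
  have h1 := congrFun (congrFun h 1) 1
  simp [NN] at h0 h1
  rcases v2_ne hx with h | h <;> tauto
lemma NN_det (x : V2) : (NN x).det = 0 := by simp [NN, det_fin_two]; ring

lemma exists_one {x : V2} (hx : x ≠ 0) (y : V2) : ∃ A : M2, A.IsSymm ∧ A *ᵥ x = y := by
  have hxx := v2_sq hx
  obtain ⟨A, h, h', -⟩ := exists_two (x := x) (y := y) (u := ![- x 1, x 0])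
    (v := ![(-y 0 * x 1 + y 1 * x 0) * x 0 / (x 0 ^2 + x 1 ^2), (-y 0 * x 1 + y 1 * x 0) * x 1 / (x 0 ^2 + x 1 ^2)])
    (by simp; nlinarith) (by simp; field_simp)
  exact ⟨A, h, h'⟩

structure Hyp (Φ : M2 → M2) : Prop where
  sym : ∀ A : M2, A.IsSymm → (Φ A).IsSymm
  zero : Φ 0 = 0
  adj : ∀ A B : M2, A.IsSymm → B.IsSymm →
    ((A - B ≠ 0 ∧ (A - B).det = 0) ↔ (Φ A - Φ B ≠ 0 ∧ (Φ A - Φ B).det = 0))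

lemma Hyp.inj {Φ : M2 → M2} (H : Hyp Φ) {A B : M2} (hA : A.IsSymm) (hB : B.IsSymm)
    (h : Φ A = Φ B) : A = B := by
  by_contra hne
  have hne' : A - B ≠ 0 := sub_ne_zero.2 hne
  by_cases hd : (A - B).det = 0
  · have := (H.adj A B hA hB).1 ⟨hne', hd⟩
    exact this.1 (by rw [h, sub_self])
  · have key : ∀ t : ℝ, t ≠ 0 → ((A - B) + !![t, 0; 0, 0]).det = 0 := by
      intro t ht
      have hs : (A + !![t, 0; 0, 0]).IsSymm := by
        apply sym_of
        have := sym01 hA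
        simp [this]
      have h1 := (H.adj (A + !![t, 0; 0, 0]) A hs hA).1 (by
        constructor
        · intro h
          have := congrFun (congrFun h 0) 0
          simp at this
          exact ht this
        · simp [det_fin_two])
      rw [h] at h1
      have h2 := (H.adj (A + !![t, 0; 0, 0]) B hs hB).2 h1
      have h3 := h2.2
      rwa [add_sub_right_comm] at h3
    have k1 := key 1 (by norm_num)
    have k2 := key (-1) (by norm_num)
    simp [det_fin_two] at k1 k2 hd
    apply hd
    linear_combination (k1 + k2) / 2

lemma Hyp.det_ne {Φ : M2 → M2} (H : Hyp Φ) {A B : M2} (hA : A.IsSymm) (hB : B.IsSymm)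
    (h : (A - B).det ≠ 0) : (Φ A - Φ B).det ≠ 0 := by
  intro h'
  by_cases he : Φ A = Φ B
  · have := H.inj hA hB he
    rw [this] at h
    simp at h
  · exact h ((H.adj A B hA hB).2 ⟨sub_ne_zero.2 he, h'⟩).2

lemma det_of_ker {A : M2} {x : V2} (hx : x ≠ 0) (h : A *ᵥ x = 0) : A.det = 0 := by
  by_contra hd
  exact hx (mv_inj hd h)

lemma exists_ker {A : M2} (h : A.det = 0) : ∃ x : V2, x ≠ 0 ∧ A *ᵥ x = 0 :=
  Matrix.exists_mulVec_eq_zero_iff.2 h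

lemma Hyp.exF {Φ : M2 → M2} (H : Hyp Φ) (x y : V2) (hx : x ≠ 0) :
    ∃ x' y' : V2, x' ≠ 0 ∧ ∀ A : M2, A.IsSymm → (A *ᵥ x = y ↔ Φ A *ᵥ x' = y') := by
  obtain ⟨A, hA, hAx⟩ := exists_one hx y
  have hline : ∀ B : M2, B.IsSymm → B *ᵥ x = y → B ≠ A → Φ B - Φ A ≠ 0 ∧ (Φ B - Φ A).det = 0 := by
    intro B hB hBx hne
    apply (H.adj B A hB hA).1
    refine ⟨sub_ne_zero.2 hne, det_of_ker hx ?_⟩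
    rw [sub_mulVec, hBx, hAx, sub_self]
  have hBs : ∀ t : ℝ, (A + t • NN x).IsSymm := fun t => hA.add ((NN_symm x).smul t)
  have hBx : ∀ t : ℝ, (A + t • NN x) *ᵥ x = y := fun t => by
    rw [add_mulVec, smul_mulVec, NN_mv, hAx]; simp
  set B := A + (1 : ℝ) • NN x with hBdef
  have hBA : B ≠ A := by
    simp [hBdef, NN_ne hx]
  obtain ⟨h1, h2⟩ := hline B (hBs 1) (hBx 1) hBA
  obtain ⟨x', hx', hk⟩ := exists_ker h2
  have fwd : ∀ C : M2, C.IsSymm → C *ᵥ x = y → Φ C *ᵥ x' = Φ A *ᵥ x' := by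
    intro C hC hCx
    by_cases hCA : C = A
    · rw [hCA]
    have hd := (hline C hC hCx hCA).2
    have hd2 : ((Φ C - Φ A) - (Φ B - Φ A)).det = 0 := by
      rw [sub_sub_sub_cancel_right]
      by_cases hCB : C = B
      · rw [hCB]; simp
      · refine ((H.adj C B hC (hBs 1)).1 ⟨sub_ne_zero.2 hCB, det_of_ker hx ?_⟩).2
        rw [sub_mulVec, hCx, hBx, sub_self]
    have := null_lem2 ((H.sym C hC).sub (H.sym A hA)) ((H.sym B (hBs 1)).sub (H.sym A hA)) hx' hk h1
      hd hd2
    rwa [sub_mulVec, sub_eq_zero] at this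
  refine ⟨x', Φ A *ᵥ x', hx', fun C hC => ⟨fwd C hC, fun hCx => ?_⟩⟩
  by_contra hne
  have hdet : ∀ t : ℝ, (C - (A + t • NN x)).det = 0 := by
    intro t
    have hk2 : (Φ C - Φ (A + t • NN x)) *ᵥ x' = 0 := by
      rw [sub_mulVec, hCx, fwd _ (hBs t) (hBx t), sub_self]
    have hne2 : Φ C ≠ Φ (A + t • NN x) := by
      intro h
      apply hne
      rw [H.inj hC (hBs t) h, hBx]
    exact ((H.adj C _ hC (hBs t)).2 ⟨sub_ne_zero.2 hne2, det_of_ker hx' hk2⟩).2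
  apply hne
  have h0 : (C - A).det = 0 := by simpa using hdet 0
  have h1' : ((C - A) - NN x).det = 0 := by
    have := hdet 1
    rwa [one_smul, ← sub_sub] at this
  have := null_lem2 (hC.sub hA) (NN_symm x) hx (NN_mv x) (NN_ne hx) h0 h1'
  rw [sub_mulVec, sub_eq_zero] at this
  rw [this, hAx]

structure FH (Φ : M2 → M2) (F1 F2 : V2 → V2 → V2) : Prop extends Hyp Φ where
  ne : ∀ x y, x ≠ 0 → F1 x y ≠ 0
  iff : ∀ x y, x ≠ 0 → ∀ A : M2, A.IsSymm → (A *ᵥ x = y ↔ Φ A *ᵥ F1 x y = F2 x y)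

lemma Hyp.exFH {Φ : M2 → M2} (H : Hyp Φ) : ∃ F1 F2, FH Φ F1 F2 := by
  choose F1 F2 h1 h2 using H.exF
  classical
  refine ⟨fun x y => if hx : x ≠ 0 then F1 x y hx else 0,
    fun x y => if hx : x ≠ 0 then F2 x y hx else 0, H, ?_, ?_⟩
  · intro x y hx; simpa [hx] using h1 x y hx
  · intro x y hx; simpa [hx] using h2 x y hx

lemma sym_form {A : M2} (hA : A.IsSymm) {x y u v : V2} (h1 : A *ᵥ x = y) (h2 : A *ᵥ u = v) :
    x 0 * v 0 + x 1 * v 1 = y 0 * u 0 + y 1 * u 1 := by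
  have := sym01 hA
  rw [mv_eq] at h1 h2
  rw [this] at h1 h2
  linear_combination -x 0 * h2.1 - x 1 * h2.2 + u 0 * h1.1 + u 1 * h1.2

variable {Φ : M2 → M2} {F1 F2 : V2 → V2 → V2}

lemma FH.perp (H : FH Φ F1 F2) {x y u v : V2} (hi : x 0 * u 1 - x 1 * u 0 ≠ 0)
    (hc : x 0 * v 0 + x 1 * v 1 = y 0 * u 0 + y 1 * u 1) :
    (F1 x y) 0 * (F2 u v) 0 + (F1 x y) 1 * (F2 u v) 1 =
      (F2 x y) 0 * (F1 u v) 0 + (F2 x y) 1 * (F1 u v) 1 := by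
  obtain ⟨A, hA, h1, h2⟩ := exists_two hi hc
  have hx : x ≠ 0 := by rintro rfl; simp at hi
  have hu : u ≠ 0 := by rintro rfl; simp at hi
  exact sym_form (H.sym A hA) ((H.iff x y hx A hA).1 h1) ((H.iff u v hu A hA).1 h2)

lemma FH.F2_zero (H : FH Φ F1 F2) {x : V2} (hx : x ≠ 0) : F2 x 0 = 0 := by
  have := (H.iff x 0 hx 0 isSymm_zero).1 (by simp)
  rw [← this, H.zero]; simp

lemma one_symm : (1 : M2).IsSymm := isSymm_one

lemma FH.F2_one (H : FH Φ F1 F2) {x : V2} (hx : x ≠ 0) : F2 x x = Φ 1 *ᵥ F1 x x :=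
  ((H.iff x x hx 1 isSymm_one).1 (by simp)).symm

lemma FH.N_det (H : FH Φ F1 F2) : (Φ 1).det ≠ 0 := by
  have := H.det_ne (A := 1) (B := 0) isSymm_one isSymm_zero (by simp)
  simpa [H.zero] using this

/-- injectivity on null lines -/
lemma FH.nopar (H : FH Φ F1 F2) {x y u v : V2} (hx : x ≠ 0) (hu : u ≠ 0) {k : ℝ}
    (h1 : F1 x y = k • F1 u v) (h2 : F2 x y = k • F2 u v) {A : M2} (hA : A.IsSymm)
    (h : A *ᵥ u = v) : A *ᵥ x = y := by
  rw [H.iff x y hx A hA, h1, h2, mulVec_smul, (H.iff u v hu A hA).1 h]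

lemma par_of_cross {a b : V2} (hb : b ≠ 0) (h : a 0 * b 1 = a 1 * b 0) : ∃ k : ℝ, a = k • b := by
  rcases v2_ne hb with h0 | h0
  · refine ⟨a 0 / b 0, v2_ext ?_ ?_⟩
    · simp; field_simp
    · simp; field_simp; linarith
  · refine ⟨a 1 / b 1, v2_ext ?_ ?_⟩
    · simp; field_simp; linarith
    · simp; field_simp

lemma combo {a b : V2} (h : a 0 * b 1 - a 1 * b 0 ≠ 0) (c : V2) : ∃ α β : ℝ, c = α • a + β • b := by
  refine ⟨(c 0 * b 1 - c 1 * b 0) / (a 0 * b 1 - a 1 * b 0),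
    (a 0 * c 1 - a 1 * c 0) / (a 0 * b 1 - a 1 * b 0), v2_ext ?_ ?_⟩
  · simp only [Pi.add_apply, Pi.smul_apply, smul_eq_mul]
    rw [div_mul_eq_mul_div, div_mul_eq_mul_div, ← add_div, eq_div_iff h]; ring
  · simp only [Pi.add_apply, Pi.smul_apply, smul_eq_mul]
    rw [div_mul_eq_mul_div, div_mul_eq_mul_div, ← add_div, eq_div_iff h]; ring

lemma lin4 {a b c d e up vp uq vq : V2} (ha : a ≠ 0) (hc : c ≠ 0)
    (hp1 : a 0 * vp 0 + a 1 * vp 1 = 0) (hq1 : a 0 * vq 0 + a 1 * vq 1 = 0)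
    (hp2 : b 0 * vp 0 + b 1 * vp 1 = c 0 * up 0 + c 1 * up 1)
    (hq2 : b 0 * vq 0 + b 1 * vq 1 = c 0 * uq 0 + c 1 * uq 1)
    (hp3 : d 0 * vp 0 + d 1 * vp 1 = e 0 * up 0 + e 1 * up 1)
    (hq3 : d 0 * vq 0 + d 1 * vq 1 = e 0 * uq 0 + e 1 * uq 1)
    (hup : up ≠ 0) (hind : ¬ ∃ k : ℝ, uq = k • up ∧ vq = k • vp)
    (hup' : uq ≠ 0) (hind' : ¬ ∃ k : ℝ, up = k • uq ∧ vp = k • vq) :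
    ∃ α β : ℝ, d = α • a + β • b ∧ e = β • c := by
  wlog hvp : vp ≠ 0 generalizing up vp uq vq
  · by_cases hvq : vq ≠ 0
    · exact this hq1 hp1 hq2 hp2 hq3 hp3 hup' hind' hup hind hvq
    · exfalso
      push Not at hvp hvq
      subst hvp hvq
      simp at hp2 hq2
      by_cases hcr : uq 0 * up 1 = uq 1 * up 0
      · obtain ⟨k, hk⟩ := par_of_cross hup hcr
        exact hind ⟨k, hk, by simp⟩
      · apply hcr
        rcases v2_ne hc with h | h
        · have : c 0 * (uq 0 * up 1 - uq 1 * up 0) = 0 := by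
            linear_combination - up 1 * hq2 + uq 1 * hp2
          have := (mul_eq_zero.1 this).resolve_left h
          linarith
        · have : c 1 * (uq 0 * up 1 - uq 1 * up 0) = 0 := by
            linear_combination - uq 0 * hp2 + up 0 * hq2
          have := (mul_eq_zero.1 this).resolve_left h
          linarith
  have hpar : ∀ s t : V2, s ≠ 0 → t ≠ 0 → ∀ r : V2, s 0 * t 0 + s 1 * t 1 = 0 →
      r 0 * t 0 + r 1 * t 1 = 0 → ∃ k : ℝ, r = k • s := by
    intro s t hs ht r h1 h2
    apply par_of_cross hs
    rcases v2_ne ht with h | h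
    · have : t 0 * (r 0 * s 1 - r 1 * s 0) = 0 := by linear_combination s 1 * h2 - r 1 * h1
      have := (mul_eq_zero.1 this).resolve_left h
      linarith
    · have : t 1 * (r 0 * s 1 - r 1 * s 0) = 0 := by linear_combination - s 0 * h2 + r 0 * h1
      have := (mul_eq_zero.1 this).resolve_left h
      linarith
  obtain ⟨k, hk⟩ := hpar vp a hvp ha vq (by linarith) (by linarith)
  set u0 : V2 := uq - k • up with hu0
  have hu0n : u0 ≠ 0 := by
    intro h
    exact hind ⟨k, sub_eq_zero.1 h, hk⟩
  have hk0 : vq 0 = k * vp 0 := by rw [hk]; simp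
  have hk1 : vq 1 = k * vp 1 := by rw [hk]; simp
  have hc0 : c 0 * u0 0 + c 1 * u0 1 = 0 := by
    simp [hu0]
    rw [hk0, hk1] at hq2
    linear_combination - hq2 + k * hp2
  have he0 : e 0 * u0 0 + e 1 * u0 1 = 0 := by
    simp [hu0]
    rw [hk0, hk1] at hq3
    linear_combination - hq3 + k * hp3
  obtain ⟨β, hβ⟩ := hpar c u0 hc hu0n e hc0 he0
  obtain ⟨α, hα⟩ := hpar a vp ha hvp (d - β • b) hp1 (by
    rw [hβ] at hp3
    simp at hp3 ⊢
    linear_combination hp3 - β * hp2)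
  exact ⟨α, β, by rw [← hα]; abel, hβ⟩

lemma FH.coll (H : FH Φ F1 F2) {x y : V2} (hx : x ≠ 0) (hy : y ≠ 0) (hxy : x + y ≠ 0) :
    ∃ α β : ℝ, F1 (x + y) y = α • F1 x 0 + β • F1 y y ∧ F2 (x + y) y = β • F2 y y := by
  have hxx := v2_sq hx
  have hyy := v2_sq hy
  by_cases hd : x 0 * y 0 + x 1 * y 1 = 0
  · have hi : x 0 * y 1 - x 1 * y 0 ≠ 0 := by
      intro h
      have : (x 0 ^ 2 + x 1 ^ 2) * (y 0 ^ 2 + y 1 ^ 2) = 0 := by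
        linear_combination (x 0 * y 0 + x 1 * y 1) * hd + (x 0 * y 1 - x 1 * y 0) * h
      rcases mul_eq_zero.1 this with h | h <;> linarith
    obtain ⟨D, hD, h1, h2⟩ := exists_two (x := x) (y := 0) (u := y) (v := y) hi (by simpa using hd)
    have h3 : D *ᵥ (x + y) = y := by rw [mulVec_add, h1, h2, zero_add]
    have e1 := (H.iff x 0 hx D hD).1 h1
    have e2 := (H.iff y y hy D hD).1 h2
    have e3 := (H.iff (x + y) y hxy D hD).1 h3
    have hne : (F1 x 0) 0 * (F1 y y) 1 - (F1 x 0) 1 * (F1 y y) 0 ≠ 0 := by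
      intro h
      obtain ⟨k, hk⟩ := par_of_cross (H.ne y y hy) (sub_eq_zero.1 h)
      have := H.nopar hx hy hk (by rw [← e1, hk, mulVec_smul, e2]) isSymm_one (by simp)
      simp at this
      exact hx this
    obtain ⟨α, β, h⟩ := combo hne (F1 (x + y) y)
    refine ⟨α, β, h, ?_⟩
    rw [← e3, h, mulVec_add, mulVec_smul, mulVec_smul, e1, e2, H.F2_zero hx]
    simp
  · obtain ⟨up, vp, uq, vq, p1, p2, p3, q1, q2, q3, P1, P2, P3, Q1, Q2, Q3, hind, hind'⟩ :
      ∃ up vp uq vq : V2, x 0 * up 1 - x 1 * up 0 ≠ 0 ∧ y 0 * up 1 - y 1 * up 0 ≠ 0 ∧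
        (x + y) 0 * up 1 - (x + y) 1 * up 0 ≠ 0 ∧
        x 0 * uq 1 - x 1 * uq 0 ≠ 0 ∧ y 0 * uq 1 - y 1 * uq 0 ≠ 0 ∧
        (x + y) 0 * uq 1 - (x + y) 1 * uq 0 ≠ 0 ∧
        x 0 * vp 0 + x 1 * vp 1 = (0 : V2) 0 * up 0 + (0 : V2) 1 * up 1 ∧
        y 0 * vp 0 + y 1 * vp 1 = y 0 * up 0 + y 1 * up 1 ∧
        (x + y) 0 * vp 0 + (x + y) 1 * vp 1 = y 0 * up 0 + y 1 * up 1 ∧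
        x 0 * vq 0 + x 1 * vq 1 = (0 : V2) 0 * uq 0 + (0 : V2) 1 * uq 1 ∧
        y 0 * vq 0 + y 1 * vq 1 = y 0 * uq 0 + y 1 * uq 1 ∧
        (x + y) 0 * vq 0 + (x + y) 1 * vq 1 = y 0 * uq 0 + y 1 * uq 1 ∧
        (∃ A : M2, A.IsSymm ∧ A *ᵥ up = vp ∧ A *ᵥ uq ≠ vq) ∧
        (∃ A : M2, A.IsSymm ∧ A *ᵥ uq = vq ∧ A *ᵥ up ≠ vp) := by
      by_cases hi : x 0 * y 1 - x 1 * y 0 = 0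
      · -- parallel
        obtain ⟨k, hk⟩ := par_of_cross (a := y) hx (by linarith)
        have hk0 : k ≠ 0 := by rintro rfl; simp at hk; exact hy hk
        have hk1 : 1 + k ≠ 0 := by
          intro h; apply hxy; rw [hk]
          have : x + k • x = (1 + k) • x := by rw [add_smul, one_smul]
          rw [this, h, zero_smul]
        subst hk
        have hJ : (![- x 1, x 0] : V2) ≠ 0 := by
          intro h
          have a := congrFun h 0
          have b := congrFun h 1
          simp at a b
          exact hx (v2_ext b a)
        have d1 : x 0 * x 0 + x 1 * x 1 ≠ 0 := by nlinarith
        have d2 : k * x 0 * x 0 + k * x 1 * x 1 ≠ 0 := by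
          have := mul_ne_zero hk0 d1
          intro h; apply this; linarith
        have d3 : (x 0 + k * x 0) * x 0 + (x 1 + k * x 1) * x 1 ≠ 0 := by
          have := mul_ne_zero hk1 d1
          intro h; apply this; linarith
        refine ⟨![- x 1, x 0], 0, ![- x 1, x 0], ![- x 1, x 0], ?_, ?_, ?_, ?_, ?_, ?_, ?_, ?_, ?_,
          ?_, ?_, ?_, ⟨0, isSymm_zero, by simp, by simpa using hJ.symm⟩, ⟨1, isSymm_one, by simp, by simpa using hJ⟩⟩
        all_goals simp
        all_goals first | assumption | ring
      · -- independent
        have hu : ∀ s t : ℝ, ∃ a b : ℝ, s • x + t • y = a • ![- x 1, x 0] + b • (![- y 1, y 0] : V2) :=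
          fun s t => combo (a := ![- x 1, x 0]) (b := ![- y 1, y 0])
            (by simp; intro h; apply hi; linarith) _
        obtain ⟨a, b, hab⟩ := hu 1 (-1)
        obtain ⟨a', b', hab'⟩ := hu 1 2
        have E0 := congrFun hab 0
        have E1 := congrFun hab 1
        have E0' := congrFun hab' 0
        have E1' := congrFun hab' 1
        simp at E0 E1 E0' E1'
        have key : ((x + (-1 : ℝ) • y : V2)) 0 * (x + (2 : ℝ) • y : V2) 1 -
            (x + (-1 : ℝ) • y : V2) 1 * (x + (2 : ℝ) • y : V2) 0 ≠ 0 := by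
          simp; intro h; apply hi; linarith
        have key' : ((x + (2 : ℝ) • y : V2)) 0 * (x + (-1 : ℝ) • y : V2) 1 -
            (x + (2 : ℝ) • y : V2) 1 * (x + (-1 : ℝ) • y : V2) 0 ≠ 0 := by
          simp; intro h; apply hi; linarith
        have sep : ∀ (u v u' v' : V2), u 0 * u' 1 - u 1 * u' 0 ≠ 0 →
            ∃ A : M2, A.IsSymm ∧ A *ᵥ u = v ∧ A *ᵥ u' ≠ v' := by
          intro u v u' v' h
          have hun : u ≠ 0 := by rintro rfl; simp at h
          obtain ⟨A, hA, hAu⟩ := exists_one hun v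
          by_cases hc : A *ᵥ u' = v'
          · refine ⟨A + NN u, hA.add (NN_symm u), by rw [add_mulVec, NN_mv, hAu, add_zero], ?_⟩
            rw [add_mulVec, hc]
            intro h0
            rw [add_eq_left, mv_eq] at h0
            simp [NN] at h0
            obtain ⟨h1, h2⟩ := h0
            rcases v2_ne hun with g | g
            · have : u 0 * (u 0 * u' 1 - u 1 * u' 0) = 0 := by linear_combination h2
              rcases mul_eq_zero.1 this with h' | h'
              · exact g h'
              · exact h h'
            · have : u 1 * (u 0 * u' 1 - u 1 * u' 0) = 0 := by linear_combination - h1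
              rcases mul_eq_zero.1 this with h' | h'
              · exact g h'
              · exact h h'
          · exact ⟨A, hA, hAu, hc⟩
        refine ⟨x + (-1 : ℝ) • y, a • ![- x 1, x 0], x + (2 : ℝ) • y, a' • ![- x 1, x 0],
          ?_, ?_, ?_, ?_, ?_, ?_, ?_, ?_, ?_, ?_, ?_, ?_, sep _ _ _ _ key, sep _ _ _ _ key'⟩
        · simp; intro h; apply hi; linarith
        · simp; intro h; apply hi; linarith
        · simp; intro h; apply hi; linarith
        · simp; intro h; apply hi; linarith
        · simp; intro h; apply hi; linarith
        · simp; intro h; apply hi; linarith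
        · simp; ring
        · simp; linear_combination - y 0 * E0 - y 1 * E1
        · simp; linear_combination - y 0 * E0 - y 1 * E1
        · simp; ring
        · simp; linear_combination - y 0 * E0' - y 1 * E1'
        · simp; linear_combination - y 0 * E0' - y 1 * E1'
    have hup : up ≠ 0 := by rintro rfl; simp at p1
    have huq : uq ≠ 0 := by rintro rfl; simp at q1
    have r1 := H.perp p1 P1
    have r2 := H.perp p2 P2
    have r3 := H.perp p3 P3
    have s1 := H.perp q1 Q1
    have s2 := H.perp q2 Q2
    have s3 := H.perp q3 Q3
    rw [H.F2_zero hx] at r1 s1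
    simp only [Pi.zero_apply, zero_mul, add_zero] at r1 s1
    have hF2 : F2 y y ≠ 0 := by
      rw [H.F2_one hy]; exact mv_ne H.N_det (H.ne y y hy)
    refine lin4 (H.ne x 0 hx) hF2 r1 s1 r2 s2 r3 s3 (H.ne _ _ hup) ?_ (H.ne _ _ huq) ?_
    · rintro ⟨k, k1, k2⟩
      obtain ⟨A, hA, h1, h2⟩ := hind
      exact h2 (H.nopar huq hup k1 k2 hA h1)
    · rintro ⟨k, k1, k2⟩
      obtain ⟨A, hA, h1, h2⟩ := hind'
      exact h2 (H.nopar hup huq k1 k2 hA h1)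

lemma FH.coll' (H : FH Φ F1 F2) {x y : V2} (hx : x ≠ 0) (hy : y ≠ 0) (hxy : x + y ≠ 0) :
    ∃ α β : ℝ, α ≠ 0 ∧ β ≠ 0 ∧ F1 (x + y) y = α • F1 x 0 + β • F1 y y ∧
      F2 (x + y) y = β • F2 y y := by
  obtain ⟨α, β, h1, h2⟩ := H.coll hx hy hxy
  refine ⟨α, β, ?_, ?_, h1, h2⟩
  · rintro rfl
    have := H.nopar hxy hy (k := β) (by simpa using h1) h2 isSymm_one (by simp)
    simp at this
    exact hx this
  · rintro rfl
    have := H.nopar hxy hx (k := α) (v := 0) (by simpa using h1) (by rw [h2, H.F2_zero hx]; simp)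
      isSymm_zero (by simp)
    simp at this
    exact hy this.symm

lemma FH.hom (H : FH Φ F1 F2) {x : V2} (hx : x ≠ 0) {k : ℝ} (hk : k ≠ 0) :
    ∃ l : ℝ, l ≠ 0 ∧ F1 (k • x) 0 = l • F1 x 0 := by
  have hkx : k • x ≠ 0 := smul_ne_zero hk hx
  have h1 := (H.iff x 0 hx _ (NN_symm x)).1 (NN_mv x)
  have h2 := (H.iff (k • x) 0 hkx _ (NN_symm x)).1 (by rw [mulVec_smul, NN_mv, smul_zero])
  rw [H.F2_zero hx] at h1
  rw [H.F2_zero hkx] at h2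
  have hne : Φ (NN x) ≠ 0 := by
    intro h
    exact NN_ne hx (H.inj (NN_symm x) isSymm_zero (by rw [h, H.zero]))
  have hcr : (F1 (k • x) 0) 0 * (F1 x 0) 1 = (F1 (k • x) 0) 1 * (F1 x 0) 0 := by
    by_contra hcr
    apply hne
    rw [mv_eq] at h1 h2
    obtain ⟨a1, a2⟩ := h1
    obtain ⟨b1, b2⟩ := h2
    have hc := sub_ne_zero.2 hcr
    simp only [Pi.zero_apply] at a1 a2 b1 b2
    apply m2_ext <;> simp only [Matrix.zero_apply] <;> apply (mul_eq_zero.1 _).resolve_right hc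
    · linear_combination (F1 x 0) 1 * b1 - (F1 (k • x) 0) 1 * a1
    · linear_combination - (F1 x 0) 0 * b1 + (F1 (k • x) 0) 0 * a1
    · linear_combination (F1 x 0) 1 * b2 - (F1 (k • x) 0) 1 * a2
    · linear_combination - (F1 x 0) 0 * b2 + (F1 (k • x) 0) 0 * a2
  obtain ⟨l, hl⟩ := par_of_cross (H.ne x 0 hx) hcr
  refine ⟨l, ?_, hl⟩
  rintro rfl
  exact H.ne _ 0 hkx (by simpa using hl)

lemma FH.g_inj (H : FH Φ F1 F2) {x u : V2} (hx : x ≠ 0) (hu : u ≠ 0) {k : ℝ}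
    (h : F1 x 0 = k • F1 u 0) : x 0 * u 1 = x 1 * u 0 := by
  have := H.nopar hx hu h (by rw [H.F2_zero hx, H.F2_zero hu, smul_zero]) (NN_symm u) (NN_mv u)
  rw [mv_eq] at this
  simp [NN] at this
  obtain ⟨h1, h2⟩ := this
  rcases v2_ne hu with g | g
  · have : u 0 * (u 0 * x 1 - u 1 * x 0) = 0 := by linear_combination h2
    have := (mul_eq_zero.1 this).resolve_left g
    linarith
  · have : u 1 * (u 0 * x 1 - u 1 * x 0) = 0 := by linear_combination - h1
    have := (mul_eq_zero.1 this).resolve_left g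
    linarith

structure Gen (T : M2) : Prop where
  sym : T.IsSymm
  det : T.det ≠ 0
  det1 : (1 + T).det ≠ 0

lemma Gen.cay {T : M2} (h : Gen T) : ∃ C : M2, C.IsSymm ∧ (∀ x, C *ᵥ (x + T *ᵥ x) = T *ᵥ x) ∧
    C.det ≠ 0 ∧ (1 - C).det ≠ 0 := by
  have hu : IsUnit (1 + T).det := isUnit_iff_ne_zero.2 h.det1
  have e1 : T * (1 + T)⁻¹ * (1 + T) = T := by
    rw [Matrix.mul_assoc, Matrix.nonsing_inv_mul _ hu, Matrix.mul_one]
  have hcomm : T * (1 + T)⁻¹ = (1 + T)⁻¹ * T := by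
    have : (1 + T) * (T * (1 + T)⁻¹) = (1 + T) * ((1 + T)⁻¹ * T) := by
      rw [← Matrix.mul_assoc, ← Matrix.mul_assoc, Matrix.mul_nonsing_inv _ hu]
      have : (1 + T) * T = T * (1 + T) := by noncomm_ring
      rw [this, Matrix.mul_assoc, Matrix.mul_nonsing_inv _ hu]; simp
    have h2 := congrArg (fun X => (1 + T)⁻¹ * X) this
    simpa [← Matrix.mul_assoc, Matrix.nonsing_inv_mul _ hu] using h2
  refine ⟨T * (1 + T)⁻¹, ?_, ?_, ?_, ?_⟩
  · unfold Matrix.IsSymm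
    rw [transpose_mul, transpose_nonsing_inv, transpose_add, h.sym.eq, transpose_one, hcomm]
  · intro x
    have : x + T *ᵥ x = (1 + T) *ᵥ x := by rw [add_mulVec, one_mulVec]
    rw [this, mulVec_mulVec, e1]
  · intro hd
    have := congrArg Matrix.det e1
    rw [det_mul, hd, zero_mul] at this
    exact h.det this.symm
  · intro hd
    have e2 : (1 - T * (1 + T)⁻¹) * (1 + T) = 1 := by
      rw [Matrix.sub_mul, e1]; simp
    have := congrArg Matrix.det e2
    rw [det_mul, hd, zero_mul] at this
    simp at this

lemma Gen.add_ne {T : M2} (h : Gen T) {x : V2} (hx : x ≠ 0) : x + T *ᵥ x ≠ 0 := by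
  have : x + T *ᵥ x = (1 + T) *ᵥ x := by rw [add_mulVec, one_mulVec]
  rw [this]; exact mv_ne h.det1 hx

lemma FH.gen (H : FH Φ F1 F2) {T : M2} (h : Gen T) : ∃ U W : M2, U.det ≠ 0 ∧ W.det ≠ 0 ∧
    ∀ x : V2, x ≠ 0 → ∀ α β : ℝ,
      F1 (x + T *ᵥ x) (T *ᵥ x) = α • F1 x 0 + β • F1 (T *ᵥ x) (T *ᵥ x) →
      F2 (x + T *ᵥ x) (T *ᵥ x) = β • F2 (T *ᵥ x) (T *ᵥ x) →
      α • (U *ᵥ F1 x 0) = β • (W *ᵥ F1 (T *ᵥ x) (T *ᵥ x)) := by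
  obtain ⟨C, hC, hCx, hd1, hd2⟩ := h.cay
  refine ⟨Φ C, Φ 1 - Φ C, ?_, H.det_ne isSymm_one hC hd2, ?_⟩
  · have := H.det_ne hC isSymm_zero (by simpa using hd1)
    simpa [H.zero] using this
  · intro x hx α β h1 h2
    have := (H.iff _ _ (h.add_ne hx) C hC).1 (hCx x)
    rw [h1, h2, H.F2_one (mv_ne h.det hx), mulVec_add, mulVec_smul, mulVec_smul] at this
    rw [sub_mulVec, smul_sub, ← this]
    abel

lemma mv_inv {A : M2} (h : A.det ≠ 0) (x : V2) : A⁻¹ *ᵥ (A *ᵥ x) = x := by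
  rw [mulVec_mulVec, Matrix.nonsing_inv_mul _ (isUnit_iff_ne_zero.2 h), one_mulVec]
lemma mv_inv' {A : M2} (h : A.det ≠ 0) (x : V2) : A *ᵥ (A⁻¹ *ᵥ x) = x := by
  rw [mulVec_mulVec, Matrix.mul_nonsing_inv _ (isUnit_iff_ne_zero.2 h), one_mulVec]

lemma inv_det_ne {A : M2} (h : A.det ≠ 0) : A⁻¹.det ≠ 0 := by
  rw [Matrix.det_nonsing_inv]; simpa using h

lemma FH.gen1 (H : FH Φ F1 F2) {T : M2} (h : Gen T) : ∃ S : M2, S.det ≠ 0 ∧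
    ∀ x : V2, x ≠ 0 → ∃ k : ℝ, k ≠ 0 ∧ F1 (T *ᵥ x) (T *ᵥ x) = k • (S *ᵥ F1 x 0) := by
  obtain ⟨U, W, hU, hW, hh⟩ := H.gen h
  refine ⟨W⁻¹ * U, by rw [det_mul]; exact mul_ne_zero (inv_det_ne hW) hU, fun x hx => ?_⟩
  obtain ⟨α, β, hα, hβ, h1, h2⟩ := H.coll' hx (mv_ne h.det hx) (h.add_ne hx)
  have := hh x hx α β h1 h2
  refine ⟨α / β, div_ne_zero hα hβ, ?_⟩
  have h3 := congrArg (fun v => β⁻¹ • (W⁻¹ *ᵥ v)) this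
  simp only [mulVec_smul, mv_inv hW, smul_smul] at h3
  rw [inv_mul_cancel₀ hβ, one_smul] at h3
  rw [← h3, mulVec_mulVec, div_eq_inv_mul]

lemma gen_one : Gen (1 : M2) := ⟨isSymm_one, by simp, by simp [det_fin_two]⟩

def Eqv (g : V2 → V2) (T : M2) : Prop := ∃ S : M2, S.det ≠ 0 ∧
  ∀ x : V2, x ≠ 0 → ∃ k : ℝ, k ≠ 0 ∧ g (T *ᵥ x) = k • (S *ᵥ g x)

lemma FH.eqv_gen (H : FH Φ F1 F2) {T : M2} (h : Gen T) : Eqv (fun x => F1 x 0) T := by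
  obtain ⟨S, hS, hS'⟩ := H.gen1 h
  obtain ⟨S1, hS1, hS1'⟩ := H.gen1 gen_one
  refine ⟨S1⁻¹ * S, by rw [det_mul]; exact mul_ne_zero (inv_det_ne hS1) hS, fun x hx => ?_⟩
  obtain ⟨k, hk, e⟩ := hS' x hx
  obtain ⟨l, hl, e'⟩ := hS1' (T *ᵥ x) (mv_ne h.det hx)
  rw [one_mulVec, e] at e'
  refine ⟨k / l, div_ne_zero hk hl, ?_⟩
  have h3 := congrArg (fun v => l⁻¹ • (S1⁻¹ *ᵥ v)) e'
  simp only [mulVec_smul, mv_inv hS1, smul_smul] at h3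
  rw [inv_mul_cancel₀ hl, one_smul] at h3
  simp only
  rw [← h3, mulVec_mulVec, div_eq_inv_mul]

lemma FH.eqv_sym (H : FH Φ F1 F2) {T : M2} (hs : T.IsSymm) (hd : T.det ≠ 0) :
    Eqv (fun x => F1 x 0) T := by
  have hdet : ∀ m : ℝ, m ≠ 0 → (m • T).det ≠ 0 := by
    intro m hm
    rw [det_smul]; exact mul_ne_zero (by simpa using hm) hd
  obtain ⟨m, hm, hg⟩ : ∃ m : ℝ, m ≠ 0 ∧ Gen (m • T) := by
    by_contra hc
    push Not at hc
    have key : ∀ m : ℝ, m ≠ 0 → (1 + m • T).det = 0 := by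
      intro m hm
      by_contra h
      exact hc m hm ⟨hs.smul m, hdet m hm, h⟩
    have k1 := key 1 (by norm_num)
    have k2 := key (-1) (by norm_num)
    have k3 := key 2 (by norm_num)
    simp [det_fin_two] at k1 k2 k3
    linarith
  obtain ⟨S, hS, h⟩ := H.eqv_gen hg
  refine ⟨S, hS, fun x hx => ?_⟩
  obtain ⟨k, hk, e⟩ := h x hx
  obtain ⟨l, hl, e'⟩ := H.hom (mv_ne hd hx) hm
  simp only [smul_mulVec] at e
  rw [e'] at e
  refine ⟨k / l, div_ne_zero hk hl, ?_⟩
  have h3 := congrArg (fun v => l⁻¹ • v) e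
  simp only [smul_smul] at h3
  rw [inv_mul_cancel₀ hl, one_smul] at h3
  simp only
  rw [h3, div_eq_inv_mul]

lemma Eqv.mul {g : V2 → V2} {T T' : M2} (h : Eqv g T) (h' : Eqv g T') (hd : T'.det ≠ 0) :
    Eqv g (T * T') := by
  obtain ⟨S, hS, e⟩ := h
  obtain ⟨S', hS', e'⟩ := h'
  refine ⟨S * S', by rw [det_mul]; exact mul_ne_zero hS hS', fun x hx => ?_⟩
  obtain ⟨k, hk, a⟩ := e _ (mv_ne hd hx)
  obtain ⟨k', hk', a'⟩ := e' x hx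
  refine ⟨k * k', mul_ne_zero hk hk', ?_⟩
  rw [← mulVec_mulVec, a, a', mulVec_smul, mulVec_mulVec, smul_smul]

lemma FH.eqv_diag (H : FH Φ F1 F2) {l : ℝ} (hl : l ≠ 0) : Eqv (fun x => F1 x 0) !![l, 0; 0, 1] :=
  H.eqv_sym (sym_of (by simp)) (by simpa [det_fin_two] using hl)

lemma FH.eqv_trans (H : FH Φ F1 F2) (t : ℝ) : Eqv (fun x => F1 x 0) !![1, t; 0, 1] := by
  have := (H.eqv_sym (T := !![t, 1; 1, 0]) (sym_of (by simp)) (by simp [det_fin_two])).mul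
    (H.eqv_sym (T := !![0, 1; 1, 0]) (sym_of (by simp)) (by simp [det_fin_two])) (by simp [det_fin_two])
  simpa [Matrix.mul_fin_two] using this

lemma phi_id (φ : ℝ → ℝ) (hi : Function.Injective φ) (h0 : φ 0 = 0) (h1 : φ 1 = 1)
    (hm : ∀ l : ℝ, l ≠ 0 → ∃ m, ∀ s, φ (l * s) = m * φ s)
    (ha : ∀ t : ℝ, ∃ a b, ∀ s, φ (s + t) = a * φ s + b) : ∀ s, φ s = s := by
  have mul : ∀ l s, φ (l * s) = φ l * φ s := by
    intro l s
    by_cases hl : l = 0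
    · simp [hl, h0]
    · obtain ⟨m, h⟩ := hm l hl
      have := h 1
      rw [mul_one, h1, mul_one] at this
      rw [h, this]
  choose a b hab using ha
  have hb : ∀ t, b t = φ t := by
    intro t
    have := hab t 0
    rw [zero_add, h0, mul_zero, zero_add] at this
    exact this.symm
  have hk : ∀ t, a t - 1 = (a 1 - 1) * φ t := by
    intro t
    have e1 := hab t 1
    have e2 := hab 1 t
    rw [hb, h1] at e1 e2
    rw [add_comm] at e1
    linear_combination e2 - e1
  have hk0 : a 1 - 1 = 0 := by
    by_contra hne
    have e : ∀ s, φ (s + 1) = φ s + 1 + (a 1 - 1) * φ s := by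
      intro s; rw [hab 1 s, hb, h1]; ring
    -- φ (2 * (1+1)) = φ 2 * φ (1+1)
    have f1 := mul 2 (1 + 1)
    have f2 : φ (2 * (1 + 1)) = φ 2 + φ 2 + (a 1 - 1) * φ 2 * φ 2 := by
      have : (2 : ℝ) * (1 + 1) = 2 + 2 := by norm_num
      rw [this, hab 2 2, hb]
      linear_combination φ 2 * hk 2
    rw [e 1, h1] at f1
    have f3 : (a 1 - 1) * (φ 2 * (φ 2 - 1)) = 0 := by linear_combination f1 - f2
    have f4 := (mul_eq_zero.1 f3).resolve_left hne
    rcases mul_eq_zero.1 f4 with h | h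
    · have : (2 : ℝ) = 0 := hi (by rw [h, h0])
      norm_num at this
    · have : (2 : ℝ) = 1 := hi (by rw [h1]; linarith)
      norm_num at this
  have add : ∀ s t, φ (s + t) = φ s + φ t := by
    intro s t
    have := hk t
    rw [hk0, zero_mul] at this
    rw [hab t s, hb]
    linear_combination φ s * this
  let r : ℝ →+* ℝ := { toFun := φ, map_zero' := h0, map_one' := h1, map_mul' := mul, map_add' := add }
  intro s
  have : r = RingHom.id ℝ := Subsingleton.elim _ _
  exact congrArg (fun f => f s) this

structure PH (g : V2 → V2) : Prop where
  ne : ∀ x, x ≠ 0 → g x ≠ 0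
  hom : ∀ x, x ≠ 0 → ∀ k : ℝ, k ≠ 0 → ∃ l : ℝ, l ≠ 0 ∧ g (k • x) = l • g x
  inj : ∀ x u, x ≠ 0 → u ≠ 0 → ∀ k : ℝ, g x = k • g u → x 0 * u 1 = x 1 * u 0
  diag : ∀ l : ℝ, l ≠ 0 → Eqv g !![l, 0; 0, 1]
  trans : ∀ t : ℝ, Eqv g !![1, t; 0, 1]

lemma FH.ph (H : FH Φ F1 F2) : PH (fun x => F1 x 0) :=
  ⟨fun x hx => H.ne x 0 hx, fun _ hx _ hk => H.hom hx hk, fun _ _ hx hu _ h => H.g_inj hx hu h,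
    fun _ hl => H.eqv_diag hl, fun t => H.eqv_trans t⟩

lemma e1_ne : (![1, 0] : V2) ≠ 0 := fun h => by have := congrFun h 0; simp at this
lemma e2_ne (s : ℝ) : (![s, 1] : V2) ≠ 0 := fun h => by have := congrFun h 1; simp at this

lemma PH.norm {h : V2 → V2} (P : PH h) (h1 : (h ![1, 0]) 1 = 0) (h2 : (h ![0, 1]) 0 = 0)
    (h3 : (h ![1, 1]) 0 = (h ![1, 1]) 1) : ∀ x, x ≠ 0 → ∃ k : ℝ, k ≠ 0 ∧ h x = k • x := by
  have h10 : (h ![1, 0]) 0 ≠ 0 := fun hc => P.ne _ e1_ne (v2_ext hc h1)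
  have hs1 : ∀ s : ℝ, (h ![s, 1]) 1 ≠ 0 := by
    intro s hc
    have := P.inj ![s, 1] ![1, 0] (e2_ne s) e1_ne ((h ![s, 1]) 0 / (h ![1, 0]) 0) (by
      apply v2_ext
      · simp; field_simp
      · simp [hc, h1])
    simp at this
  have hid := phi_id (fun s => (h ![s, 1]) 0 / (h ![s, 1]) 1) ?_ (by simp [h2])
    (by (try simp only); rw [h3]; exact div_self (hs1 1)) ?_ ?_
  · intro x hx
    by_cases hx1 : x 1 = 0
    · have hx0 : x 0 ≠ 0 := (v2_ne hx).resolve_right (by simpa using hx1)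
      have hxe : x = x 0 • ![1, 0] := v2_ext (by simp) (by simp [hx1])
      obtain ⟨l, hl, e⟩ := P.hom _ e1_ne (x 0) hx0
      rw [← hxe] at e
      refine ⟨l * (h ![1, 0]) 0 / x 0, div_ne_zero (mul_ne_zero hl h10) hx0, ?_⟩
      rw [e]
      apply v2_ext
      · simp; field_simp
      · simp [h1, hx1]
    · have hxe : x = x 1 • ![x 0 / x 1, 1] := v2_ext (by simp; field_simp) (by simp)
      obtain ⟨l, hl, e⟩ := P.hom _ (e2_ne (x 0 / x 1)) (x 1) hx1
      rw [← hxe] at e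
      have h4 := hid (x 0 / x 1)
      have h5 := hs1 (x 0 / x 1)
      try simp only at h4
      refine ⟨l * (h ![x 0 / x 1, 1]) 1 / x 1, div_ne_zero (mul_ne_zero hl h5) hx1, ?_⟩
      rw [e]
      rw [div_eq_iff h5] at h4
      apply v2_ext
      · simp only [Pi.smul_apply, smul_eq_mul]
        rw [h4]; field_simp
      · simp; field_simp
  · intro s t hst
    try simp only at hst
    have a := hs1 s
    have b := hs1 t
    have := P.inj ![s, 1] ![t, 1] (e2_ne s) (e2_ne t) ((h ![s, 1]) 1 / (h ![t, 1]) 1) (by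
      apply v2_ext
      · simp; rw [div_eq_div_iff a b] at hst; field_simp; linarith
      · simp; field_simp)
    simpa using this
  · intro l hl
    obtain ⟨S, hS, e⟩ := P.diag l hl
    have S10 : S 1 0 = 0 := by
      obtain ⟨k, hk, a⟩ := e _ e1_ne
      obtain ⟨m, hm, b⟩ := P.hom _ e1_ne l hl
      have : !![l, 0; 0, 1] *ᵥ ![1, 0] = l • (![1, 0] : V2) := by
        rw [mv_eq]; simp
      rw [this, b] at a
      have := congrFun a 1
      simp [mv1, h1] at this
      tauto
    have S01 : S 0 1 = 0 := by
      obtain ⟨k, hk, a⟩ := e _ (e2_ne 0)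
      have : !![l, 0; 0, 1] *ᵥ ![0, 1] = (![0, 1] : V2) := by
        rw [mv_eq]; simp
      rw [this] at a
      have h6 := congrFun a 0
      have h7 := hs1 0
      rw [h2, Pi.smul_apply, mv0, h2, mul_zero, zero_add, smul_eq_mul] at h6
      rcases mul_eq_zero.1 h6.symm with h | h
      · exact absurd h hk
      · exact (mul_eq_zero.1 h).resolve_right h7
    refine ⟨S 0 0 / S 1 1, fun s => ?_⟩
    obtain ⟨k, hk, a⟩ := e _ (e2_ne s)
    have : !![l, 0; 0, 1] *ᵥ ![s, 1] = (![l * s, 1] : V2) := by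
      rw [mv_eq]; simp
    rw [this] at a
    try simp only
    rw [a]
    rw [det_fin_two, S10, mul_zero, sub_zero] at hS
    have := (mul_ne_zero_iff.1 hS).2
    have := hs1 s
    simp [mv0, mv1, S10, S01]
    field_simp
  · intro t
    obtain ⟨S, hS, e⟩ := P.trans t
    have S10 : S 1 0 = 0 := by
      obtain ⟨k, hk, a⟩ := e _ e1_ne
      have : !![1, t; 0, 1] *ᵥ ![1, 0] = (![1, 0] : V2) := by
        rw [mv_eq]; simp
      rw [this] at a
      have := congrFun a 1
      simp [mv1, h1] at this
      tauto
    refine ⟨S 0 0 / S 1 1, S 0 1 / S 1 1, fun s => ?_⟩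
    obtain ⟨k, hk, a⟩ := e _ (e2_ne s)
    have : !![1, t; 0, 1] *ᵥ ![s, 1] = (![s + t, 1] : V2) := by
      rw [mv_eq]; simp
    rw [this] at a
    try simp only
    rw [a]
    rw [det_fin_two, S10, mul_zero, sub_zero] at hS
    have := (mul_ne_zero_iff.1 hS).2
    have := hs1 s
    simp [mv0, mv1, S10]
    field_simp

lemma PH.conj {g : V2 → V2} (P : PH g) {G : M2} (hG : G.det ≠ 0) : PH (fun x => G *ᵥ g x) := by
  have E : ∀ T, Eqv g T → Eqv (fun x => G *ᵥ g x) T := by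
    rintro T ⟨S, hS, e⟩
    refine ⟨G * S * G⁻¹, ?_, ?_⟩
    · rw [det_mul, det_mul]
      exact mul_ne_zero (mul_ne_zero hG hS) (inv_det_ne hG)
    · intro x hx
      obtain ⟨k, hk, a⟩ := e x hx
      refine ⟨k, hk, ?_⟩
      try simp only
      rw [a, mulVec_smul, ← mulVec_mulVec, mv_inv hG, mulVec_mulVec]
  refine ⟨fun x hx => mv_ne hG (P.ne x hx), ?_, ?_, fun l hl => E _ (P.diag l hl),
    fun t => E _ (P.trans t)⟩
  · intro x hx k hk
    obtain ⟨l, hl, e⟩ := P.hom x hx k hk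
    exact ⟨l, hl, by (try simp only); rw [e, mulVec_smul]⟩
  · intro x u hx hu k h
    apply P.inj x u hx hu k
    have := congrArg (fun v => G⁻¹ *ᵥ v) h
    simpa only [mulVec_smul, mv_inv hG] using this

lemma PH.proj {g : V2 → V2} (P : PH g) : ∃ G : M2, G.det ≠ 0 ∧
    ∀ x, x ≠ 0 → ∃ k : ℝ, k ≠ 0 ∧ g x = k • (G *ᵥ x) := by
  have hab : (g ![1, 0]) 0 * (g ![0, 1]) 1 - (g ![1, 0]) 1 * (g ![0, 1]) 0 ≠ 0 := by
    intro h
    obtain ⟨k, hk⟩ := par_of_cross (P.ne _ (e2_ne 0)) (sub_eq_zero.1 h)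
    have := P.inj _ _ e1_ne (e2_ne 0) k hk
    simp at this
  obtain ⟨α, β, hc⟩ := combo hab (g ![1, 1])
  have hα : α ≠ 0 := by
    rintro rfl
    have := P.inj _ _ (e2_ne 1) (e2_ne 0) β (by simpa using hc)
    simp at this
  have hβ : β ≠ 0 := by
    rintro rfl
    have := P.inj _ _ (e2_ne 1) e1_ne α (by simpa using hc)
    simp at this
  set a := g ![1, 0] with ha
  set b := g ![0, 1] with hb
  set G : M2 := !![α * a 0, β * b 0; α * a 1, β * b 1] with hGdef
  have hG : G.det ≠ 0 := by
    have := mul_ne_zero (mul_ne_zero hα hβ) hab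
    intro h
    apply this
    rw [hGdef, det_fin_two] at h
    simp at h
    linear_combination h
  have n1 : G⁻¹ *ᵥ a = ![α⁻¹, 0] := by
    have : a = G *ᵥ ![α⁻¹, 0] := by
      symm; rw [mv_eq]; simp [hGdef]; constructor <;> field_simp
    rw [this, mv_inv hG]
  have n2 : G⁻¹ *ᵥ b = ![0, β⁻¹] := by
    have : b = G *ᵥ ![0, β⁻¹] := by
      symm; rw [mv_eq]; simp [hGdef]; constructor <;> field_simp
    rw [this, mv_inv hG]
  have n3 : G⁻¹ *ᵥ g ![1, 1] = ![1, 1] := by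
    have : g ![1, 1] = G *ᵥ ![1, 1] := by
      symm; rw [mv_eq, hc]; simp [hGdef]
    rw [this, mv_inv hG]
  have := (P.conj (inv_det_ne hG)).norm (by (try simp only); rw [← ha, n1]; simp)
    (by (try simp only); rw [← hb, n2]; simp) (by (try simp only); rw [n3]; simp)
  refine ⟨G, hG, fun x hx => ?_⟩
  obtain ⟨k, hk, e⟩ := this x hx
  refine ⟨k, hk, ?_⟩
  rw [← mulVec_smul, ← e, mv_inv' hG]

lemma scal {A B : M2} (hB : B.det ≠ 0) (h : ∀ x : V2, x ≠ 0 → ∃ k : ℝ, A *ᵥ x = k • (B *ᵥ x)) :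
    ∃ k0 : ℝ, ∀ x : V2, x ≠ 0 → ∀ k : ℝ, A *ᵥ x = k • (B *ᵥ x) → k = k0 := by
  obtain ⟨k1, h1⟩ := h _ e1_ne
  obtain ⟨k2, h2⟩ := h _ (e2_ne 0)
  obtain ⟨k3, h3⟩ := h _ (e2_ne 1)
  have e3 : (![1, 1] : V2) = ![1, 0] + ![0, 1] := by simp
  have hz : B *ᵥ ![k1 - k3, k2 - k3] = 0 := by
    have : (![k1 - k3, k2 - k3] : V2) = (k1 - k3) • ![1, 0] + (k2 - k3) • ![0, 1] := by simp
    rw [this, mulVec_add, mulVec_smul, mulVec_smul, sub_smul, sub_smul, ← h1, ← h2]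
    rw [e3, mulVec_add, mulVec_add, smul_add] at h3
    rw [sub_add_sub_comm, h3, sub_self]
  have hz' := mv_inj hB hz
  have z0 : k1 - k3 = 0 := by simpa using congrFun hz' 0
  have z1 : k2 - k3 = 0 := by simpa using congrFun hz' 1
  have k21 : k2 = k1 := by linarith
  rw [k21] at h2
  refine ⟨k1, fun x hx k hk => ?_⟩
  have hxe : x = x 0 • ![1, 0] + x 1 • ![0, 1] := v2_ext (by simp) (by simp)
  have hA : A *ᵥ x = k1 • (B *ᵥ x) := by
    rw [hxe]
    simp only [mulVec_add, mulVec_smul, h1, h2]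
    rw [smul_add, smul_comm, smul_comm (x 1)]
  rw [hA] at hk
  exact (smul_left_injective ℝ (mv_ne hB hx) hk).symm

def KK (Φ : M2 → M2) (F1 F2 : V2 → V2 → V2) (G G1 : M2) (x y : V2) (κ : ℝ) : Prop :=
  ∃ μ : ℝ, μ ≠ 0 ∧ F1 (x + y) y = μ • (G *ᵥ x + κ • (G1 *ᵥ y)) ∧
    F2 (x + y) y = (μ * κ) • (Φ 1 *ᵥ (G1 *ᵥ y))

structure GH (Φ : M2 → M2) (F1 F2 : V2 → V2 → V2) (G G1 : M2) : Prop extends FH Φ F1 F2 where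
  dG : G.det ≠ 0
  dG1 : G1.det ≠ 0
  hG : ∀ x, x ≠ 0 → ∃ k : ℝ, k ≠ 0 ∧ F1 x 0 = k • (G *ᵥ x)
  hG1 : ∀ x, x ≠ 0 → ∃ k : ℝ, k ≠ 0 ∧ F1 x x = k • (G1 *ᵥ x)

lemma FH.gh (H : FH Φ F1 F2) : ∃ G G1, GH Φ F1 F2 G G1 := by
  obtain ⟨G, dG, hG⟩ := H.ph.proj
  obtain ⟨S, dS, hS⟩ := H.gen1 gen_one
  refine ⟨G, S * G, H, dG, by rw [det_mul]; exact mul_ne_zero dS dG, hG, fun x hx => ?_⟩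
  obtain ⟨k, hk, e⟩ := hS x hx
  obtain ⟨l, hl, e'⟩ := hG x hx
  simp only [one_mulVec] at e
  refine ⟨k * l, mul_ne_zero hk hl, ?_⟩
  rw [e, e', mulVec_smul, mulVec_mulVec, smul_smul]

variable {G G1 : M2}

lemma GH.uniq (H : GH Φ F1 F2 G G1) {x y : V2} (hx : x ≠ 0) (hy : y ≠ 0) {κ κ' : ℝ}
    (h : KK Φ F1 F2 G G1 x y κ) (h' : KK Φ F1 F2 G G1 x y κ') : κ = κ' := by
  obtain ⟨μ, hμ, a, b⟩ := h
  obtain ⟨μ', hμ', a', b'⟩ := h'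
  rw [b] at b'
  have e := smul_left_injective ℝ (mv_ne H.N_det (mv_ne H.dG1 hy)) b'
  rw [a, smul_add, smul_add, smul_smul, smul_smul, e] at a'
  have a2 := add_right_cancel a'
  have e2 := smul_left_injective ℝ (mv_ne H.dG hx) a2
  subst e2
  exact mul_left_cancel₀ hμ e

lemma GH.ex (H : GH Φ F1 F2 G G1) {T : M2} (h : Gen T) :
    ∃ κ : ℝ, κ ≠ 0 ∧ ∀ x, x ≠ 0 → KK Φ F1 F2 G G1 x (T *ᵥ x) κ := by
  obtain ⟨U, W, hU, hW, hh⟩ := H.gen h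
  have key : ∀ x, x ≠ 0 → ∃ κ : ℝ, κ ≠ 0 ∧ KK Φ F1 F2 G G1 x (T *ᵥ x) κ ∧
      (U * G) *ᵥ x = κ • ((W * G1 * T) *ᵥ x) := by
    intro x hx
    have hTx := mv_ne h.det hx
    obtain ⟨α, β, hα, hβ, h1, h2⟩ := H.coll' hx hTx (h.add_ne hx)
    have e := hh x hx α β h1 h2
    obtain ⟨k, hk, a⟩ := H.hG x hx
    obtain ⟨l, hl, b⟩ := H.hG1 _ hTx
    have hαk : α * k ≠ 0 := mul_ne_zero hα hk
    refine ⟨β * l / (α * k), div_ne_zero (mul_ne_zero hβ hl) hαk, ⟨α * k, hαk, ?_, ?_⟩, ?_⟩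
    · rw [h1, a, b, smul_add, smul_smul, smul_smul, smul_smul, mul_div_cancel₀ _ hαk]
    · rw [h2, H.F2_one hTx, b, mulVec_smul, smul_smul, mul_div_cancel₀ _ hαk]
    · rw [a, b, mulVec_smul, mulVec_smul, smul_smul, smul_smul] at e
      have e' := congrArg (fun v => (α * k)⁻¹ • v) e
      simp only [smul_smul, inv_mul_cancel₀ hαk, one_smul] at e'
      rw [← mulVec_mulVec, e', Matrix.mul_assoc, ← mulVec_mulVec, ← mulVec_mulVec, div_eq_inv_mul]
  obtain ⟨k0, hk0⟩ := scal (A := U * G) (B := W * G1 * T)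
    (by rw [det_mul, det_mul]; exact mul_ne_zero (mul_ne_zero hW H.dG1) h.det)
    (fun x hx => by obtain ⟨κ, -, -, e⟩ := key x hx; exact ⟨κ, e⟩)
  refine ⟨k0, ?_, fun x hx => ?_⟩
  · obtain ⟨κ, hκ, -, e⟩ := key _ e1_ne
    rw [← hk0 _ e1_ne κ e]; exact hκ
  · obtain ⟨κ, hκ, a, e⟩ := key x hx
    rw [← hk0 x hx κ e]; exact a

lemma gen_diag {a b : ℝ} (ha : a ≠ 0) (ha' : 1 + a ≠ 0) (hb : b ≠ 0) (hb' : 1 + b ≠ 0) :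
    Gen !![a, 0; 0, b] :=
  ⟨sym_of (by simp), by simp [det_fin_two, ha, hb], by simp [det_fin_two, ha', hb']⟩

lemma GH.const (H : GH Φ F1 F2 G G1) :
    ∃ κ : ℝ, κ ≠ 0 ∧ ∀ T, Gen T → ∀ x, x ≠ 0 → KK Φ F1 F2 G G1 x (T *ᵥ x) κ := by
  obtain ⟨κ0, h0, hκ0⟩ := H.ex gen_one
  have link : ∀ T T' : M2, Gen T → Gen T' → (∃ x, x ≠ 0 ∧ T *ᵥ x = T' *ᵥ x) →
      (∀ x, x ≠ 0 → KK Φ F1 F2 G G1 x (T *ᵥ x) κ0) →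
      (∀ x, x ≠ 0 → KK Φ F1 F2 G G1 x (T' *ᵥ x) κ0) := by
    rintro T T' hT hT' ⟨x, hx, e⟩ hh
    obtain ⟨κ, -, hκ⟩ := H.ex hT'
    have a := hh x hx
    have b := hκ x hx
    rw [e] at a
    have := H.uniq hx (mv_ne hT'.det hx) a b
    rwa [this]
  refine ⟨κ0, h0, fun T hT => ?_⟩
  obtain ⟨a, x, hx, hax⟩ : ∃ (a : ℝ) (x : V2), x ≠ 0 ∧ T *ᵥ x = a • x := by
    have hs := sym01 hT.sym
    have hD : 0 ≤ (T 0 0 - T 1 1) ^ 2 + 4 * T 0 1 ^ 2 := by positivity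
    have hsq := Real.sq_sqrt hD
    set r := Real.sqrt ((T 0 0 - T 1 1) ^ 2 + 4 * T 0 1 ^ 2)
    obtain ⟨x, hx, e⟩ := exists_ker (A := T - ((T 0 0 + T 1 1 + r) / 2) • 1) (by
      simp [det_fin_two, hs]
      linear_combination hsq / 4)
    refine ⟨(T 0 0 + T 1 1 + r) / 2, x, hx, ?_⟩
    rw [sub_mulVec, sub_eq_zero, smul_mulVec, one_mulVec] at e
    exact e
  have ha : a ≠ 0 := by
    rintro rfl
    rw [zero_smul] at hax
    exact mv_ne hT.det hx hax
  have ha' : 1 + a ≠ 0 := by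
    intro h
    apply hT.add_ne hx
    rw [hax]
    have : x + a • x = (1 + a) • x := by rw [add_smul, one_smul]
    rw [this, h, zero_smul]
  have one1 : (1 : ℝ) + 1 ≠ 0 := by norm_num
  have s1 := link 1 !![a, 0; 0, 1] gen_one (gen_diag ha ha' one_ne_zero one1)
    ⟨![0, 1], e2_ne 0, by rw [one_mulVec]; symm; rw [mv_eq]; simp⟩ hκ0
  have s2 := link _ !![a, 0; 0, a] (gen_diag ha ha' one_ne_zero one1) (gen_diag ha ha' ha ha')
    ⟨![1, 0], e1_ne, by rw [mv_eq, mv0, mv1]; simp⟩ s1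
  exact link _ T (gen_diag ha ha' ha ha') hT
    ⟨x, hx, by rw [hax, mv_eq]; simp⟩ s2

lemma exists_gen {x y : V2} (hx : x ≠ 0) (hy : y ≠ 0) (hxy : x + y ≠ 0) :
    ∃ T : M2, Gen T ∧ T *ᵥ x = y := by
  obtain ⟨A, hA, hAx⟩ := exists_one hx y
  have hBs : ∀ t : ℝ, (A + t • NN x).IsSymm := fun t => hA.add ((NN_symm x).smul t)
  have hBx : ∀ t : ℝ, (A + t • NN x) *ᵥ x = y := fun t => by
    rw [add_mulVec, smul_mulVec, NN_mv, hAx]; simp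
  set q := x 0 * (A *ᵥ x) 0 + x 1 * (A *ᵥ x) 1 with hq
  have d1 : ∀ t : ℝ, (A + t • NN x).det = A.det + t * q := by
    intro t
    have := sym01 hA
    rw [hq, mv0, mv1]
    simp [det_fin_two, NN, this]; ring
  set q' := x 0 * ((1 + A) *ᵥ x) 0 + x 1 * ((1 + A) *ᵥ x) 1 with hq'
  have d2 : ∀ t : ℝ, (1 + (A + t • NN x)).det = (1 + A).det + t * q' := by
    intro t
    have := sym01 hA
    rw [hq', mv0, mv1]
    simp [det_fin_two, NN, this]; ring
  have n1 : ¬ (A.det = 0 ∧ q = 0) := by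
    rintro ⟨h1, h2⟩
    have := null_lem hA h1 h2
    rw [hAx] at this
    exact hy this
  have n2 : ¬ ((1 + A).det = 0 ∧ q' = 0) := by
    rintro ⟨h1, h2⟩
    have := null_lem (isSymm_one.add hA) h1 h2
    rw [add_mulVec, one_mulVec, hAx] at this
    exact hxy this
  obtain ⟨t, ht1, ht2⟩ : ∃ t : ℝ, A.det + t * q ≠ 0 ∧ (1 + A).det + t * q' ≠ 0 := by
    by_contra hc
    push Not at hc
    have hprod : ∀ t : ℝ, (A.det + t * q) * ((1 + A).det + t * q') = 0 := by
      intro t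
      by_cases h : A.det + t * q = 0
      · rw [h, zero_mul]
      · rw [hc t h, mul_zero]
    have p0 := hprod 0
    have p1 := hprod 1
    have p2 := hprod (-1)
    have p3 := hprod 2
    have c0 : A.det * (1 + A).det = 0 := by linear_combination p0
    have c2 : q * q' = 0 := by linear_combination (p1 + p2 - 2 * p0) / 2
    have c1 : A.det * q' + q * (1 + A).det = 0 := by linear_combination (p1 - p2) / 2
    rcases mul_eq_zero.1 c0 with h | h
    · rw [h, zero_mul, zero_add] at c1
      have hqn : q ≠ 0 := fun h' => n1 ⟨h, h'⟩
      exact n2 ⟨(mul_eq_zero.1 c1).resolve_left hqn, (mul_eq_zero.1 c2).resolve_left hqn⟩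
    · rw [h, mul_zero, add_zero] at c1
      have hqn : q' ≠ 0 := fun h' => n2 ⟨h, h'⟩
      exact n1 ⟨(mul_eq_zero.1 c1).resolve_right hqn, (mul_eq_zero.1 c2).resolve_right hqn⟩
  exact ⟨_, ⟨hBs t, by rw [d1]; exact ht1, by rw [d2]; exact ht2⟩, hBx t⟩

lemma GH.formula (H : GH Φ F1 F2 G G1) : ∃ P : M2, P.det ≠ 0 ∧ ∀ z y : V2, z ≠ 0 →
    ∃ μ : ℝ, μ ≠ 0 ∧ F1 z y = μ • (G *ᵥ (z - y) + P *ᵥ y) ∧ F2 z y = μ • (Φ 1 *ᵥ (P *ᵥ y)) := by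
  obtain ⟨κ, hκ, hh⟩ := H.const
  refine ⟨κ • G1, by rw [det_smul]; exact mul_ne_zero (by simpa using hκ) H.dG1, fun z y hz => ?_⟩
  by_cases hy : y = 0
  · subst hy
    obtain ⟨k, hk, e⟩ := H.hG z hz
    exact ⟨k, hk, by simpa using e, by rw [H.F2_zero hz]; simp⟩
  by_cases hzy : z - y = 0
  · have : z = y := sub_eq_zero.1 hzy
    subst this
    obtain ⟨k, hk, e⟩ := H.hG1 z hz
    refine ⟨k / κ, div_ne_zero hk hκ, ?_, ?_⟩
    · rw [sub_self, mulVec_zero, zero_add, smul_mulVec, smul_smul, div_mul_cancel₀ _ hκ, e]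
    · rw [H.F2_one hz, smul_mulVec, mulVec_smul, smul_smul, div_mul_cancel₀ _ hκ, e, mulVec_smul]
  obtain ⟨T, hT, hTx⟩ := exists_gen hzy hy (by simpa using hz)
  obtain ⟨μ, hμ, a, b⟩ := hh T hT _ hzy
  rw [hTx, sub_add_cancel] at a b
  exact ⟨μ, hμ, by rw [a, smul_mulVec], by rw [b, smul_mulVec, mulVec_smul, smul_smul]⟩

lemma GH.lin (H : GH Φ F1 F2 G G1) : ∀ A : M2, A.IsSymm → Φ A * G = Φ 1 * G * A := by
  obtain ⟨P, dP, hP⟩ := H.formula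
  have hPG : ∀ y, P *ᵥ y - G *ᵥ y = 0 := by
    intro y
    by_contra hne
    set z := - (G⁻¹ *ᵥ (P *ᵥ y - G *ᵥ y)) with hz
    have hz0 : z ≠ 0 := neg_ne_zero.2 (mv_ne (inv_det_ne H.dG) hne)
    obtain ⟨μ, hμ, a, b⟩ := hP z y hz0
    apply H.ne z y hz0
    rw [a, mulVec_sub, hz, mulVec_neg, mv_inv' H.dG]
    have : -(P *ᵥ y - G *ᵥ y) - G *ᵥ y + P *ᵥ y = 0 := by abel
    rw [this, smul_zero]
  intro A hA
  apply Matrix.ext_of_mulVec_single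
  intro i
  set z : V2 := Pi.single i 1
  have hz : z ≠ 0 := by
    intro h
    have := congrFun h i
    simp [z] at this
  obtain ⟨μ, hμ, a, b⟩ := hP z (A *ᵥ z) hz
  have e := (H.iff z _ hz A hA).1 rfl
  rw [a, b, sub_eq_zero.1 (hPG (A *ᵥ z)), mulVec_sub, sub_add_cancel, mulVec_smul] at e
  have := smul_right_injective V2 hμ e
  rw [← mulVec_mulVec, this, Matrix.mul_assoc, ← mulVec_mulVec, ← mulVec_mulVec]

lemma Hyp.main (H : Hyp Φ) : ∃ c : ℝ, (c = 1 ∨ c = -1) ∧ ∃ R : M2, IsUnit R ∧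
    ∀ A : M2, A.IsSymm → Φ A = c • (R * A * Rᵀ) := by
  obtain ⟨F1, F2, HF⟩ := H.exFH
  obtain ⟨G, G1, HG⟩ := HF.gh
  have hl := HG.lin
  have huG : IsUnit G.det := isUnit_iff_ne_zero.2 HG.dG
  set W := Gᵀ * Φ 1 * G with hW
  have hWA : ∀ A : M2, A.IsSymm → Gᵀ * Φ A * G = W * A := by
    intro A hA
    rw [Matrix.mul_assoc, hl A hA, hW]
    simp only [Matrix.mul_assoc]
  have hWs : ∀ A : M2, A.IsSymm → (W * A).IsSymm := by
    intro A hA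
    rw [← hWA A hA]
    unfold Matrix.IsSymm
    rw [transpose_mul, transpose_mul, transpose_transpose, (H.sym A hA).eq, Matrix.mul_assoc]
  have s1 := sym01 (hWs 1 isSymm_one)
  have s2 := sym01 (hWs !![1, 0; 0, 0] (sym_of (by simp)))
  have s3 := sym01 (hWs !![0, 1; 1, 0] (sym_of (by simp)))
  simp [Matrix.mul_apply, Fin.sum_univ_two] at s1 s2 s3
  set l := W 0 0 with hldef
  have hWl : W = l • 1 := by
    apply m2_ext <;> simp
    · rfl
    · rw [← s1, s2]
    · exact s2
    · exact s3
  have hl0 : l ≠ 0 := by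
    intro h
    rw [h, zero_smul] at hWl
    have : W.det ≠ 0 := by
      rw [hW, det_mul, det_mul, det_transpose]
      exact mul_ne_zero (mul_ne_zero HG.dG HF.N_det) HG.dG
    rw [hWl] at this
    simp at this
  have hΦ : ∀ A : M2, A.IsSymm → Φ A = l • (G⁻¹ᵀ * A * G⁻¹) := by
    intro A hA
    have h1 := hWA A hA
    rw [hWl, Matrix.smul_mul, Matrix.one_mul] at h1
    have h2 := congrArg (fun X => G⁻¹ᵀ * X * G⁻¹) h1
    simp only [Matrix.mul_smul, Matrix.smul_mul] at h2
    rw [← h2]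
    have e1 : G⁻¹ᵀ * Gᵀ = 1 := by
      rw [← transpose_mul, Matrix.mul_nonsing_inv _ huG, transpose_one]
    rw [Matrix.mul_assoc Gᵀ, ← Matrix.mul_assoc G⁻¹ᵀ, e1, Matrix.one_mul, Matrix.mul_assoc,
      Matrix.mul_nonsing_inv _ huG, Matrix.mul_one]
  have hs : 0 < |l| := abs_pos.2 hl0
  refine ⟨SignType.sign l, ?_, Real.sqrt |l| • G⁻¹ᵀ, ?_, ?_⟩
  · rcases lt_or_gt_of_ne hl0 with h | h
    · right; simp [sign_neg h]
    · left; simp [sign_pos h]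
  · rw [Matrix.isUnit_iff_isUnit_det, isUnit_iff_ne_zero, det_smul, det_transpose]
    exact mul_ne_zero (pow_ne_zero _ (Real.sqrt_pos.2 hs).ne') (inv_det_ne HG.dG)
  · intro A hA
    rw [hΦ A hA, transpose_smul, transpose_transpose]
    simp only [Matrix.smul_mul, Matrix.mul_smul, smul_smul]
    congr 1
    rw [Real.mul_self_sqrt hs.le, sign_mul_abs]

/-- A map `Φ : S_2 → S_2` preserving adjacency in both directions has the form
`Φ(A) = c R A Rᵀ + S` with `c ∈ {−1, 1}`, `R` invertible and `S ∈ S_2`. -/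
theorem form_of_adjacency_biconditional
    (Φ : Matrix (Fin 2) (Fin 2) ℝ → Matrix (Fin 2) (Fin 2) ℝ)
    (hΦsym : ∀ A : Matrix (Fin 2) (Fin 2) ℝ, A.IsSymm → (Φ A).IsSymm)
    (hΦadj : ∀ A B : Matrix (Fin 2) (Fin 2) ℝ, A.IsSymm → B.IsSymm →
      ((A - B).rank = 1 ↔ (Φ A - Φ B).rank = 1)) :
    ∃ c : ℝ, (c = 1 ∨ c = -1) ∧ ∃ R : Matrix (Fin 2) (Fin 2) ℝ, IsUnit R ∧
      ∃ S : Matrix (Fin 2) (Fin 2) ℝ, S.IsSymm ∧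
        ∀ A : Matrix (Fin 2) (Fin 2) ℝ, A.IsSymm →
          Φ A = c • (R * A * Rᵀ) + S := by
  have H : Hyp (fun A => Φ A - Φ 0) := by
    refine ⟨fun A hA => (hΦsym A hA).sub (hΦsym 0 isSymm_zero), sub_self _, fun A B hA hB => ?_⟩
    have := hΦadj A B hA hB
    rw [rank_one_iff, rank_one_iff] at this
    simpa only [sub_sub_sub_cancel_right] using this
  obtain ⟨c, hc, R, hR, h⟩ := H.main
  refine ⟨c, hc, R, hR, Φ 0, hΦsym 0 isSymm_zero, fun A hA => ?_⟩
  rw [← h A hA, sub_add_cancel]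
end

section
/- Let Φ : S_2 → S_2 be an adjacency preserving map and suppose there exist G, H ∈ S_2 with d(Φ(G), Φ(H)) = 2. Then there exist c ∈ {−1, 1}, an invertible matrix R ∈ M_2(ℝ), and S ∈ S_2 such that Φ(A) = c·R·A·Rᵀ + S for all A ∈ S_2. -/
open Matrix

lemma additive_linear (φ : ℝ →+ ℝ) (hpos : ∀ x, 0 < x → 0 < φ x * φ 1) (x : ℝ) : φ x = φ 1 * x := by
  have h1 : 0 < φ 1 * φ 1 := hpos 1 one_pos
  have hq : ∀ q : ℚ, φ (q : ℝ) = q * φ 1 := by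
    intro q
    have := map_ratCast_smul φ ℝ ℝ q (1:ℝ)
    simpa using this
  have key : ∀ y z, y < z → φ y * φ 1 < φ z * φ 1 := by
    intro y z hyz
    have := hpos (z - y) (by linarith)
    rw [map_sub] at this
    nlinarith
  have e : φ x * φ 1 = (φ 1 * φ 1) * x := by
    rcases lt_trichotomy (φ x * φ 1) ((φ 1 * φ 1) * x) with h | h | h
    · have : φ x * φ 1 / (φ 1 * φ 1) < x := by rw [div_lt_iff₀ h1]; linarith
      obtain ⟨q, hq1, hq2⟩ := exists_rat_btwn this
      have := key _ _ hq2
      rw [hq] at this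
      rw [div_lt_iff₀ h1] at hq1
      nlinarith
    · exact h
    · have : x < φ x * φ 1 / (φ 1 * φ 1) := by rw [lt_div_iff₀ h1]; linarith
      obtain ⟨q, hq1, hq2⟩ := exists_rat_btwn this
      have := key _ _ hq1
      rw [hq] at this
      rw [lt_div_iff₀ h1] at hq2
      nlinarith
  have hne : φ 1 ≠ 0 := by rintro h; simp [h] at h1
  apply mul_right_cancel₀ hne
  linarith

lemma avoid (s : Finset ℝ) : ∃ x : ℝ, ∀ y ∈ s, x ≠ y := by
  obtain ⟨x, hx⟩ := Infinite.exists_notMem_finset s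
  exact ⟨x, fun y hy h => hx (h ▸ hy)⟩

lemma KA (F G : ℝ → ℝ) (hF : ∀ a, a ≠ 0 → F a ≠ 0) (hG : ∀ a, a ≠ 0 → G a ≠ 0)
    (hinj : F 1 ≠ F 2)
    (h : ∀ s : ℝ, s ≠ 0 → ∃ r : ℝ, 0 < r ∧ ∀ a a' b b', a ≠ 0 → a' ≠ 0 → b ≠ 0 → b' ≠ 0 →
      a + s^2*b = a' + s^2*b' → a + s^2*b ≠ 0 → F a - F a' = r * (G b' - G b)) :
    ∃ p q, 0 < p * q ∧ ∀ a, a ≠ 0 → F a = p * a ∧ G a = q * a := by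
  -- increments of F are well defined
  have inc : ∀ d a1 a2, a1 ≠ 0 → a2 ≠ 0 → a1 + d ≠ 0 → a2 + d ≠ 0 →
      F (a1 + d) - F a1 = F (a2 + d) - F a2 := by
    intro d a1 a2 h1 h2 h3 h4
    obtain ⟨r, -, hr⟩ := h 1 one_ne_zero
    obtain ⟨b, hb⟩ := avoid {0, -d, -(a1+d), -(a2+d)}
    simp only [Finset.mem_insert, Finset.mem_singleton, forall_eq_or_imp, forall_eq] at hb
    obtain ⟨b0, b1, b2, b3⟩ := hb
    have b1' : b + d ≠ 0 := fun e => b1 (by linarith)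
    rw [hr (a1+d) a1 b (b+d) h3 h1 b0 b1' (by ring) (fun e => b2 (by linarith)),
      hr (a2+d) a2 b (b+d) h4 h2 b0 b1' (by ring) (fun e => b3 (by linarith))]
  have ex : ∀ d, ∃ v, ∀ a, a ≠ 0 → a + d ≠ 0 → F (a + d) - F a = v := by
    intro d
    obtain ⟨a, ha⟩ := avoid {0, -d}
    simp only [Finset.mem_insert, Finset.mem_singleton, forall_eq_or_imp, forall_eq] at ha
    exact ⟨F (a+d) - F a, fun a' h1 h2 => inc d a' a h1 ha.1 h2 (fun e => ha.2 (by linarith))⟩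
  choose φ hφ using ex
  have hadd : ∀ x y, φ (x + y) = φ x + φ y := by
    intro x y
    obtain ⟨a, ha⟩ := avoid {0, -x, -(x+y)}
    simp only [Finset.mem_insert, Finset.mem_singleton, forall_eq_or_imp, forall_eq] at ha
    obtain ⟨a0, a1, a2⟩ := ha
    have a1' : a + x ≠ 0 := fun e => a1 (by linarith)
    have a2' : a + x + y ≠ 0 := fun e => a2 (by linarith)
    rw [← hφ x a a0 a1', ← hφ y (a+x) a1' a2', ← hφ (x+y) a a0 (by rwa [← add_assoc]), ← add_assoc]
    ring
  -- relation with increments of G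
  have hG' : ∀ s : ℝ, s ≠ 0 → ∃ r : ℝ, 0 < r ∧ ∀ d b, b ≠ 0 → b + d ≠ 0 →
      φ (s^2*d) = r * (G (b + d) - G b) := by
    intro s hs
    obtain ⟨r, hr0, hr⟩ := h s hs
    refine ⟨r, hr0, fun d b hb hbd => ?_⟩
    obtain ⟨a, ha⟩ := avoid {0, -(s^2*d), -(s^2*d+s^2*b)}
    simp only [Finset.mem_insert, Finset.mem_singleton, forall_eq_or_imp, forall_eq] at ha
    obtain ⟨a0, a1, a2⟩ := ha
    have a1' : a + s^2*d ≠ 0 := fun e => a1 (by linarith)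
    rw [← hφ (s^2*d) a a0 a1']
    exact hr _ _ _ _ a1' a0 hb hbd (by ring) (fun e => a2 (by linarith))
  have hφ1 : φ 1 ≠ 0 := by
    rw [← hφ 1 1 one_ne_zero (by norm_num)]
    intro e
    apply hinj
    norm_num at e
    linarith
  obtain ⟨r1, hr1, hr⟩ := hG' 1 one_ne_zero
  have hlin : ∀ x, φ x = φ 1 * x := by
    refine additive_linear (AddMonoidHom.mk' φ hadd) ?_
    intro x hx
    simp only [AddMonoidHom.mk'_apply]
    obtain ⟨r2, hr2, h2⟩ := hG' (Real.sqrt x) (Real.sqrt_pos.2 hx).ne'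
    have e1 := h2 1 1 one_ne_zero (by norm_num)
    have e2 := hr 1 1 one_ne_zero (by norm_num)
    rw [Real.sq_sqrt hx.le] at e1
    simp only [mul_one, one_pow] at e1 e2
    rw [e1]
    have : G (1+1) - G 1 = φ 1 / r1 := by rw [e2]; field_simp
    rw [this]
    have : 0 < φ 1 * φ 1 := mul_self_pos.2 hφ1
    have : r2 * (φ 1 / r1) * φ 1 = r2 / r1 * (φ 1 * φ 1) := by field_simp
    rw [this]; positivity
  have fin : ∀ (p : ℝ) (F : ℝ → ℝ), p ≠ 0 → (∀ a, a ≠ 0 → F a ≠ 0) →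
      (∀ d a, a ≠ 0 → a + d ≠ 0 → F (a + d) - F a = p * d) → ∀ a, a ≠ 0 → F a = p * a := by
    intro p F hp hF hh
    have e : ∀ a, a ≠ 0 → F a = p * a + (F 1 - p) := by
      intro a ha
      have := hh (a - 1) 1 one_ne_zero (by simpa using ha)
      rw [add_sub_cancel] at this
      linarith
    have c0 : F 1 - p = 0 := by
      by_contra hc
      have hn : -(F 1 - p)/p ≠ 0 := div_ne_zero (neg_ne_zero.2 hc) hp
      apply hF _ hn
      rw [e _ hn]
      field_simp
      ring
    intro a ha
    rw [e a ha, c0, add_zero]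
  refine ⟨φ 1, φ 1 / r1, ?_, fun a ha => ⟨?_, ?_⟩⟩
  · have : 0 < φ 1 * φ 1 := mul_self_pos.2 hφ1
    rw [← mul_div_assoc]; positivity
  · exact fin _ F hφ1 hF (fun d a h1 h2 => by rw [hφ d a h1 h2, hlin]) a ha
  · refine fin _ G (div_ne_zero hφ1 hr1.ne') hG (fun d a h1 h2 => ?_) a ha
    have := hr d a h1 h2
    rw [one_pow, one_mul, hlin] at this
    field_simp
    linarith

def AP (X Y Z : ℝ → ℝ → ℝ → ℝ) : Prop := ∀ a b c a' b' c', (a-a')*(c-c') = (b-b')^2 →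
  ¬ (a = a' ∧ b = b' ∧ c = c') →
  (X a b c - X a' b' c') * (Z a b c - Z a' b' c') = (Y a b c - Y a' b' c')^2 ∧
  ¬ (X a b c = X a' b' c' ∧ Y a b c = Y a' b' c' ∧ Z a b c = Z a' b' c')

lemma kconst (D u v k D' v' k' : ℝ) (hD : D * (u*v - k^2) = 1) (hD' : D' * (u*v' - k'^2) = 1)
    (h : (D*v - D'*v')*(D*u - D'*u) = (D*k - D'*k')^2) : k = k' := by
  have h0 : D ≠ 0 := by rintro rfl; simp at hD
  have h0' : D' ≠ 0 := by rintro rfl; simp at hD'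
  have : D * D' * (k - k')^2 = 0 := by
    linear_combination -h + (D - D') * hD - (D-D') * hD'
  have : (k-k')^2 = 0 := by
    rcases mul_eq_zero.1 this with h | h
    · exact absurd h (mul_ne_zero h0 h0')
    · exact h
  have := pow_eq_zero_iff (two_ne_zero) |>.1 this
  linarith

lemma K (X Y Z : ℝ → ℝ → ℝ → ℝ) (h : AP X Y Z)
    (h1 : ∀ a, Y a 0 0 = 0 ∧ Z a 0 0 = 0) (h2 : ∀ b, Y 0 0 b = 0 ∧ X 0 0 b = 0) :
    ∃ p q, 0 < p * q ∧ ∀ a b, X a 0 b = p * a ∧ Y a 0 b = 0 ∧ Z a 0 b = q * b := by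
  obtain ⟨f, hf⟩ : ∃ f : ℝ → ℝ, ∀ a, X a 0 0 = f a := ⟨fun a => X a 0 0, fun _ => rfl⟩
  obtain ⟨g, hg⟩ : ∃ g : ℝ → ℝ, ∀ a, Z 0 0 a = g a := ⟨fun a => Z 0 0 a, fun _ => rfl⟩
  have f0 : f 0 = 0 := by rw [← hf]; exact (h2 0).2
  have g0 : g 0 = 0 := by rw [← hg]; exact (h1 0).2
  have finj : ∀ a a', a ≠ a' → f a ≠ f a' := by
    intro a a' hne e
    apply (h a 0 0 a' 0 0 (by ring) (by tauto)).2
    simp [hf, e, h1]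
  have ginj : ∀ a a', a ≠ a' → g a ≠ g a' := by
    intro a a' hne e
    apply (h 0 0 a 0 0 a' (by ring) (by tauto)).2
    simp [hg, e, h2]
  have fne : ∀ a, a ≠ 0 → f a ≠ 0 := fun a ha => f0 ▸ finj a 0 ha
  have gne : ∀ a, a ≠ 0 → g a ≠ 0 := fun a ha => g0 ▸ ginj a 0 ha
  have base : ∀ a b, a ≠ 0 → b ≠ 0 → (X a 0 b - f a) * Z a 0 b = (Y a 0 b)^2 ∧
      X a 0 b * (Z a 0 b - g b) = (Y a 0 b)^2 := by
    intro a b ha hb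
    have e1 := (h a 0 b a 0 0 (by ring) (by tauto)).1
    have e2 := (h a 0 b 0 0 b (by ring) (by tauto)).1
    rw [hf, (h1 a).1, (h1 a).2] at e1
    rw [hg, (h2 b).1, (h2 b).2] at e2
    simp only [sub_zero] at e1 e2
    exact ⟨e1, e2⟩
  have zne : ∀ a b, a ≠ 0 → b ≠ 0 → Z a 0 b ≠ 0 := by
    intro a b ha hb hz
    obtain ⟨e1, e2⟩ := base a b ha hb
    have hy : Y a 0 b = 0 := by
      rw [hz, mul_zero] at e1; exact pow_eq_zero_iff (two_ne_zero) |>.1 e1.symm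
    have hx : X a 0 b = 0 := by
      rw [hz, hy] at e2
      have := gne b hb
      have : X a 0 b * g b = 0 := by linear_combination -e2
      simp_all
    have hb2 : 2 * b ≠ 0 := by simpa using hb
    obtain ⟨e3, e4⟩ := base a (2*b) ha hb2
    have e5 := h a 0 (2*b) a 0 b (by ring) (by intro hh; apply hb; linarith [hh.2.2])
    rw [hx, hy, hz] at e5
    simp only [sub_zero] at e5
    have hz' : Z a 0 (2*b) = 0 := by
      have : f a * Z a 0 (2*b) = 0 := by linear_combination e5.1 - e3
      exact (mul_eq_zero.1 this).resolve_left (fne a ha)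
    have hy' : Y a 0 (2*b) = 0 := by
      rw [hz', mul_zero] at e3; exact pow_eq_zero_iff (two_ne_zero) |>.1 e3.symm
    have hx' : X a 0 (2*b) = 0 := by
      have : X a 0 (2*b) * g (2*b) = 0 := by
        rw [hz', hy'] at e4
        linear_combination -e4
      exact (mul_eq_zero.1 this).resolve_right (gne _ hb2)
    exact e5.2 ⟨hx', hy', hz'⟩
  have par : ∀ a b, ∃ D k, a ≠ 0 → b ≠ 0 → D ≠ 0 ∧ X a 0 b = D * (g b)⁻¹ ∧ Y a 0 b = D * k ∧
      Z a 0 b = D * (f a)⁻¹ ∧ D * ((f a)⁻¹ * (g b)⁻¹ - k^2) = 1 := by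
    intro a b
    refine ⟨f a * Z a 0 b, Y a 0 b / (f a * Z a 0 b), fun ha hb => ?_⟩
    have hfa := fne a ha
    have hgb := gne b hb
    have hz := zne a b ha hb
    obtain ⟨e1, e2⟩ := base a b ha hb
    have e3 : f a * Z a 0 b = g b * X a 0 b := by linear_combination e2 - e1
    refine ⟨mul_ne_zero hfa hz, ?_, ?_, ?_, ?_⟩
    · rw [e3]; field_simp
    · field_simp
    · field_simp
    · field_simp
      rw [← e1]
      linear_combination Z a 0 b * e3
  choose D k hDk using par
  have kc1 : ∀ a b b', a ≠ 0 → b ≠ 0 → b' ≠ 0 → k a b = k a b' := by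
    intro a b b' ha hb hb'
    by_cases hbb : b = b'
    · rw [hbb]
    obtain ⟨_, x1, y1, z1, d1⟩ := hDk a b ha hb
    obtain ⟨_, x2, y2, z2, d2⟩ := hDk a b' ha hb'
    have e := (h a 0 b a 0 b' (by ring) (by tauto)).1
    rw [x1, y1, z1, x2, y2, z2] at e
    exact kconst _ _ _ _ _ _ _ d1 d2 e
  have kc2 : ∀ a a' b, a ≠ 0 → a' ≠ 0 → b ≠ 0 → k a b = k a' b := by
    intro a a' b ha ha' hb
    by_cases hbb : a = a'
    · rw [hbb]
    obtain ⟨_, x1, y1, z1, d1⟩ := hDk a b ha hb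
    obtain ⟨_, x2, y2, z2, d2⟩ := hDk a' b ha' hb
    have e := (h a 0 b a' 0 b (by ring) (by tauto)).1
    rw [x1, y1, z1, x2, y2, z2] at e
    refine kconst (D a b) (g b)⁻¹ (f a)⁻¹ _ (D a' b) (f a')⁻¹ _ ?_ ?_ ?_
    · rw [← d1]; ring
    · rw [← d2]; ring
    · rw [← e]; ring
  obtain ⟨κ, hκ⟩ : ∃ κ, ∀ a b, a ≠ 0 → b ≠ 0 → k a b = κ :=
    ⟨k 1 1, fun a b ha hb => by rw [kc1 a b 1 ha hb one_ne_zero, kc2 a 1 1 ha one_ne_zero one_ne_zero]⟩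
  obtain ⟨F, hF⟩ : ∃ F : ℝ → ℝ, ∀ a, F a = (f a⁻¹)⁻¹ := ⟨_, fun _ => rfl⟩
  obtain ⟨G, hG⟩ : ∃ G : ℝ → ℝ, ∀ a, G a = (g a⁻¹)⁻¹ := ⟨_, fun _ => rfl⟩
  have Finj : ∀ a b, a ≠ b → F a ≠ F b := by
    intro a b hab e
    rw [hF, hF, _root_.inv_inj] at e
    exact finj _ _ (fun e => hab (_root_.inv_inj.1 e)) e
  have Ginj : ∀ a b, a ≠ b → G a ≠ G b := by
    intro a b hab e
    rw [hG, hG, _root_.inv_inj] at e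
    exact ginj _ _ (fun e => hab (_root_.inv_inj.1 e)) e
  -- third directions
  have nul : ∀ s t, s ≠ 0 → t ≠ 0 → X t (t*s) (t*s^2) * Z t (t*s) (t*s^2) = (Y t (t*s) (t*s^2))^2 := by
    intro s t hs ht
    have e := (h t (t*s) (t*s^2) 0 0 0 (by ring) (by tauto)).1
    rw [(h1 0).1, (h1 0).2, (h2 0).2] at e
    simpa using e
  have lin : ∀ s t a b, s ≠ 0 → t ≠ 0 → a ≠ 0 → b ≠ 0 → t * (a + s^2*b) = 1 →
      X t (t*s) (t*s^2) * F a + Z t (t*s) (t*s^2) * G b - 2 * κ * Y t (t*s) (t*s^2) = 1 := by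
    intro s t a b hs ht ha hb hab
    have ha' := inv_ne_zero ha
    have hb' := inv_ne_zero hb
    obtain ⟨hD, x1, y1, z1, d1⟩ := hDk a⁻¹ b⁻¹ ha' hb'
    have e := (h t (t*s) (t*s^2) a⁻¹ 0 b⁻¹ (by
      field_simp
      linear_combination - hab) (fun hh => mul_ne_zero ht hs hh.2.1)).1
    rw [x1, y1, z1, ← hF, ← hG, hκ _ _ ha' hb'] at e
    rw [← hF, ← hG, hκ _ _ ha' hb'] at d1
    have n := nul s t hs ht
    apply mul_left_cancel₀ hD
    linear_combination n - e + D a⁻¹ b⁻¹ * d1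
  have Xne : ∀ s t, s ≠ 0 → t ≠ 0 → X t (t*s) (t*s^2) ≠ 0 := by
    intro s t hs ht hx
    have n := nul s t hs ht
    rw [hx, zero_mul] at n
    have hy := pow_eq_zero_iff (two_ne_zero) |>.1 n.symm
    have l1 := lin s t (2/t) (-1/(t*s^2)) hs ht (by positivity) (div_ne_zero (by norm_num) (by positivity)) (by field_simp; norm_num)
    have l2 := lin s t (-1/t) (2/(t*s^2)) hs ht (div_ne_zero (by norm_num) (by positivity)) (by positivity) (by field_simp; norm_num)
    rw [hx, hy] at l1 l2
    have hz : Z t (t*s) (t*s^2) ≠ 0 := by intro hz; rw [hz] at l1; simp at l1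
    refine Ginj (-1/(t*s^2)) (2/(t*s^2)) ?_ (mul_left_cancel₀ hz (by linarith))
    intro e
    field_simp at e
    norm_num at e
  have Zne : ∀ s t, s ≠ 0 → t ≠ 0 → Z t (t*s) (t*s^2) ≠ 0 := by
    intro s t hs ht hx
    have n := nul s t hs ht
    rw [hx, mul_zero] at n
    have hy := pow_eq_zero_iff (two_ne_zero) |>.1 n.symm
    have l1 := lin s t (2/t) (-1/(t*s^2)) hs ht (by positivity) (div_ne_zero (by norm_num) (by positivity)) (by field_simp; norm_num)
    have l2 := lin s t (-1/t) (2/(t*s^2)) hs ht (div_ne_zero (by norm_num) (by positivity)) (by positivity) (by field_simp; norm_num)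
    rw [hx, hy] at l1 l2
    refine Finj (2/t) (-1/t) ?_ (mul_left_cancel₀ (Xne s t hs ht) (by linarith))
    intro e
    field_simp at e
    norm_num at e
  have prop : ∀ s t, s ≠ 0 → t ≠ 0 → Z t (t*s) (t*s^2) * X 1 (1*s) (1*s^2) =
      Z 1 (1*s) (1*s^2) * X t (t*s) (t*s^2) := by
    intro s t hs ht
    by_cases t1 : t = 1
    · rw [t1]
    have n := nul s t hs ht
    have n1 := nul s 1 hs one_ne_zero
    have e := (h t (t*s) (t*s^2) 1 (1*s) (1*s^2) (by ring) (by tauto)).1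
    generalize X t (t*s) (t*s^2) = x at *
    generalize Y t (t*s) (t*s^2) = y at *
    generalize Z t (t*s) (t*s^2) = z at *
    generalize X 1 (1*s) (1*s^2) = x1 at *
    generalize Y 1 (1*s) (1*s^2) = y1 at *
    generalize Z 1 (1*s) (1*s^2) = z1 at *
    have e' : x * z1 + z * x1 = 2 * y * y1 := by linear_combination n + n1 - e
    have : (z * x1 - z1 * x)^2 = 0 := by
      linear_combination (x * z1 + z * x1 + 2*y*y1) * e' - 4 * x1 * z1 * n - 4 * y^2 * n1
    have := pow_eq_zero_iff (two_ne_zero) |>.1 this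
    linarith
  obtain ⟨p, q, hpq, hFG⟩ := KA F G
    (fun a ha => by rw [hF]; exact inv_ne_zero (fne _ (inv_ne_zero ha)))
    (fun a ha => by rw [hG]; exact inv_ne_zero (gne _ (inv_ne_zero ha)))
    (Finj 1 2 (by norm_num)) (by
      intro s hs
      have hx1 := Xne s 1 hs one_ne_zero
      have hz1 := Zne s 1 hs one_ne_zero
      refine ⟨Z 1 (1*s) (1*s^2) / X 1 (1*s) (1*s^2), ?_, ?_⟩
      · have n1 := nul s 1 hs one_ne_zero
        have : 0 < X 1 (1*s) (1*s^2) * Z 1 (1*s) (1*s^2) :=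
          lt_of_le_of_ne (by rw [n1]; positivity) (mul_ne_zero hx1 hz1).symm
        rw [div_eq_mul_inv]
        rcases pos_and_pos_or_neg_and_neg_of_mul_pos this with ⟨i, j⟩ | ⟨i, j⟩
        · positivity
        · exact mul_pos_of_neg_of_neg j (inv_lt_zero.2 i)
      · intro a a' b b' ha ha' hb hb' e hne
        have ht := inv_ne_zero hne
        have l1 := lin s _ a b hs ht ha hb (inv_mul_cancel₀ hne)
        have l2 := lin s (a + s^2*b)⁻¹ a' b' hs ht ha' hb' (by rw [e]; exact inv_mul_cancel₀ (e ▸ hne))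
        have pr := prop s _ hs ht
        have hx := Xne s _ hs ht
        generalize (a + s^2*b)⁻¹ = t at *
        generalize X t (t*s) (t*s^2) = x at *
        generalize Y t (t*s) (t*s^2) = y at *
        generalize Z t (t*s) (t*s^2) = z at *
        generalize X 1 (1*s) (1*s^2) = x1 at *
        generalize Z 1 (1*s) (1*s^2) = z1 at *
        apply mul_left_cancel₀ (mul_ne_zero hx hx1)
        rw [show x * x1 * (z1 / x1 * (G b' - G b)) = x * z1 * (G b' - G b) by field_simp]
        linear_combination x1 * (l1 - l2) + (G b' - G b) * pr)
  have hp : p ≠ 0 := by rintro rfl; simp at hpq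
  have hq : q ≠ 0 := by rintro rfl; simp at hpq
  have hfp : ∀ a, f a = p⁻¹ * a := by
    intro a
    by_cases ha : a = 0
    · rw [ha, f0, mul_zero]
    have := (hFG a⁻¹ (inv_ne_zero ha)).1
    rw [hF, inv_inv] at this
    rw [← inv_inv (f a), this]; simp [mul_comm]
  have hgq : ∀ a, g a = q⁻¹ * a := by
    intro a
    by_cases ha : a = 0
    · rw [ha, g0, mul_zero]
    have := (hFG a⁻¹ (inv_ne_zero ha)).2
    rw [hG, inv_inv] at this
    rw [← inv_inv (g a), this]; simp [mul_comm]
  have κ0 : κ = 0 := by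
    by_contra hκ0
    have ha : p * q / κ^2 ≠ 0 := by positivity
    obtain ⟨hD, x1, y1, z1, d1⟩ := hDk (p * q / κ^2) 1 ha one_ne_zero
    rw [hκ _ _ ha one_ne_zero, hfp, hgq] at d1
    have : (p⁻¹ * (p * q / κ^2))⁻¹ * (q⁻¹ * 1)⁻¹ - κ^2 = 0 := by field_simp; ring
    rw [this] at d1
    simp at d1
  refine ⟨p⁻¹, q⁻¹, by rw [← mul_inv]; positivity, fun a b => ?_⟩
  by_cases ha : a = 0
  · subst ha; simp [h2, hg, hgq]
  by_cases hb : b = 0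
  · subst hb; simp [h1, hf, hfp]
  obtain ⟨hD, x1, y1, z1, d1⟩ := hDk a b ha hb
  rw [hκ a b ha hb, κ0] at d1 y1
  have hfa := fne a ha
  have hgb := gne b hb
  have hDe : D a b = f a * g b := by
    field_simp at d1
    linarith
  rw [x1, y1, z1, hDe, ← hfp, ← hgq]
  refine ⟨by field_simp, by ring, by field_simp⟩

def Sm (a b c : ℝ) : M2 := !![a, b; b, c]

lemma Sm_symm (a b c : ℝ) : (Sm a b c).IsSymm := by
  ext i j; fin_cases i <;> fin_cases j <;> simp [Sm]

lemma Sm_of (A : M2) (h : A.IsSymm) : A = Sm (A 0 0) (A 0 1) (A 1 1) := by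
  have := h.apply 0 1
  ext i j; fin_cases i <;> fin_cases j <;> simp [Sm, this]

lemma Sm_ex (A : M2) (h : A.IsSymm) : ∃ a b c, A = Sm a b c := ⟨_, _, _, Sm_of A h⟩

lemma Sm_inj (a b c a' b' c' : ℝ) : Sm a b c = Sm a' b' c' ↔ (a = a' ∧ b = b' ∧ c = c') := by
  constructor
  · intro h
    have h1 := congrFun (congrFun h 0) 0
    have h2 := congrFun (congrFun h 0) 1
    have h3 := congrFun (congrFun h 1) 1
    simp [Sm] at h1 h2 h3
    exact ⟨h1, h2, h3⟩
  · rintro ⟨rfl, rfl, rfl⟩; rfl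

lemma Sm_sub (a b c a' b' c' : ℝ) : Sm a b c - Sm a' b' c' = Sm (a-a') (b-b') (c-c') := by
  ext i j; fin_cases i <;> fin_cases j <;> simp [Sm]

lemma Sm_add (a b c a' b' c' : ℝ) : Sm a b c + Sm a' b' c' = Sm (a+a') (b+b') (c+c') := by
  ext i j; fin_cases i <;> fin_cases j <;> simp [Sm]

lemma Sm_smul (r a b c : ℝ) : r • Sm a b c = Sm (r*a) (r*b) (r*c) := by
  ext i j; fin_cases i <;> fin_cases j <;> simp [Sm]

lemma Sm_zero : Sm 0 0 0 = 0 := by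
  ext i j; fin_cases i <;> fin_cases j <;> simp [Sm]

lemma Sm_det (a b c : ℝ) : (Sm a b c).det = a * c - b^2 := by
  simp [Sm, Matrix.det_fin_two]; ring

lemma conj_Sm (x y z w a c : ℝ) : !![x, y; z, w] * Sm a 0 c * (!![x, y; z, w])ᵀ =
    Sm (a*x^2 + c*y^2) (a*x*z + c*y*w) (a*z^2+c*w^2) := by
  ext i j; fin_cases i <;> fin_cases j <;>
    simp [Sm, Matrix.mul_apply, Fin.sum_univ_two] <;> ring

lemma symm_conj (P A : M2) (h : A.IsSymm) : (P * A * Pᵀ).IsSymm := by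
  unfold Matrix.IsSymm at *
  simp [Matrix.transpose_mul, h, Matrix.mul_assoc]

def Pres (Φ : M2 → M2) : Prop := (∀ A, A.IsSymm → (Φ A).IsSymm) ∧
  ∀ A B : M2, A.IsSymm → B.IsSymm → A ≠ B → (A - B).det = 0 → Φ A ≠ Φ B ∧ (Φ A - Φ B).det = 0

lemma Pres.weak {Φ : M2 → M2} (h : Pres Φ) {A B : M2} (hA : A.IsSymm) (hB : B.IsSymm)
    (hd : (A - B).det = 0) : (Φ A - Φ B).det = 0 := by
  by_cases e : A = B
  · subst e; simp
  · exact (h.2 A B hA hB e hd).2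

lemma conj_cancel (P A B : M2) (hP : P.det ≠ 0) (h : P * A * Pᵀ = P * B * Pᵀ) : A = B := by
  have hu : IsUnit P := (Matrix.isUnit_iff_isUnit_det P).2 hP.isUnit
  have hu' : IsUnit Pᵀ := (Matrix.isUnit_iff_isUnit_det Pᵀ).2 (by rw [Matrix.det_transpose]; exact hP.isUnit)
  exact hu.mul_left_cancel (hu'.mul_right_cancel h)

lemma conj_sub (P A B : M2) : P * A * Pᵀ - P * B * Pᵀ = P * (A - B) * Pᵀ := by
  rw [Matrix.mul_sub, Matrix.sub_mul]

lemma conj_det (P A : M2) : (P * A * Pᵀ).det = P.det^2 * A.det := by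
  rw [Matrix.det_mul, Matrix.det_mul, Matrix.det_transpose]; ring

lemma Pres.conj {Φ : M2 → M2} (h : Pres Φ) (P Q : M2) (c : ℝ) (hP : P.det ≠ 0) (hQ : Q.det ≠ 0)
    (hc : c ≠ 0) : Pres (fun M => c • (Q * Φ (P * M * Pᵀ) * Qᵀ)) := by
  refine ⟨fun A hA => ?_, fun A B hA hB hne hd => ?_⟩
  · have := symm_conj Q _ (h.1 _ (symm_conj P A hA))
    unfold Matrix.IsSymm at *
    rw [Matrix.transpose_smul, this]
  · obtain ⟨h1, h2⟩ := h.2 (P*A*Pᵀ) (P*B*Pᵀ) (symm_conj P A hA) (symm_conj P B hB)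
      (fun e => hne (conj_cancel P A B hP e)) (by rw [conj_sub, conj_det, hd, mul_zero])
    refine ⟨fun e => h1 (conj_cancel Q _ _ hQ (smul_right_injective _ hc e)), ?_⟩
    simp only
    rw [← smul_sub, conj_sub, Matrix.det_smul, conj_det, h2]; simp

lemma null_form (A : M2) (hA : A.IsSymm) (hd : A.det = 0) :
    ∃ r x y, A = Sm (r*x^2) (r*x*y) (r*y^2) := by
  obtain ⟨a, b, c, rfl⟩ := Sm_ex A hA
  rw [Sm_det] at hd
  by_cases ha : a = 0
  · subst ha
    have : b = 0 := by simpa using hd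
    subst this
    exact ⟨c, 0, 1, by simp⟩
  · refine ⟨a, 1, b/a, ?_⟩
    rw [Sm_inj]
    refine ⟨by ring, by field_simp, ?_⟩
    field_simp
    linarith

lemma normal_form (A B : M2) (hA : A.IsSymm) (hB : B.IsSymm) (dA : A.det = 0) (dB : B.det = 0)
    (hd : (A - B).det ≠ 0) : ∃ R : M2, R.det ≠ 0 ∧ ∃ α β, α ≠ 0 ∧ β ≠ 0 ∧
      A = R * Sm α 0 0 * Rᵀ ∧ B = R * Sm 0 0 β * Rᵀ := by
  obtain ⟨r, x, y, rfl⟩ := null_form A hA dA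
  obtain ⟨s, z, w, rfl⟩ := null_form B hB dB
  rw [Sm_sub, Sm_det] at hd
  have e : (r * x^2 - s*z^2) * (r * y^2 - s * w^2) - (r*x*y - s*z*w)^2 = -(r * s * (x*w-z*y)^2) := by
    ring
  rw [e] at hd
  simp only [ne_eq, neg_eq_zero, mul_eq_zero, not_or, pow_eq_zero_iff two_ne_zero] at hd
  refine ⟨!![x, z; y, w], ?_, r, s, hd.1.1, hd.1.2, ?_, ?_⟩
  · rw [Matrix.det_fin_two]; simpa using hd.2
  · rw [conj_Sm, Sm_inj]; refine ⟨by ring, by ring, by ring⟩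
  · rw [conj_Sm, Sm_inj]; refine ⟨by ring, by ring, by ring⟩

lemma diag_form (A : M2) (hA : A.IsSymm) : ∃ R : M2, R.det ≠ 0 ∧ ∃ α β, A = R * Sm α 0 β * Rᵀ := by
  obtain ⟨a, b, c, rfl⟩ := Sm_ex A hA
  by_cases ha : a = 0
  · by_cases hc : c = 0
    · subst ha; subst hc
      refine ⟨!![1, 1; 1, -1], by rw [Matrix.det_fin_two]; norm_num, b/2, -b/2, ?_⟩
      rw [conj_Sm, Sm_inj]; refine ⟨by ring, by ring, by ring⟩
    · refine ⟨!![1, b/c; 0, 1], by rw [Matrix.det_fin_two]; norm_num, a - b^2/c, c, ?_⟩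
      rw [conj_Sm, Sm_inj]; refine ⟨by field_simp; ring, by field_simp; ring, by ring⟩
  · refine ⟨!![1, 0; b/a, 1], by rw [Matrix.det_fin_two]; norm_num, a, c - b^2/a, ?_⟩
    rw [conj_Sm, Sm_inj]; refine ⟨by ring, by field_simp; ring, by field_simp; ring⟩

lemma Tcoord (x1 x2 x3 y1 y2 y3 p1 p2 p3 : ℝ) (hx : x1*x3 - x2^2 = 0) (hy : y1*y3 - y2^2 = 0)
    (hxy : (x1-y1)*(x3-y3) - (x2-y2)^2 = 0) (hpx : (p1-x1)*(p3-x3)-(p2-x2)^2 = 0)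
    (hpy : (p1-y1)*(p3-y3)-(p2-y2)^2 = 0) (hne : ¬ (x1 = y1 ∧ x2 = y2 ∧ x3 = y3)) :
    p1*p3 - p2^2 = 0 := by
  obtain ⟨n1, hn1⟩ : ∃ n, n = x1 - y1 := ⟨_, rfl⟩
  obtain ⟨n2, hn2⟩ : ∃ n, n = x2 - y2 := ⟨_, rfl⟩
  obtain ⟨n3, hn3⟩ : ∃ n, n = x3 - y3 := ⟨_, rfl⟩
  obtain rfl : y1 = x1 - n1 := by linarith
  obtain rfl : y2 = x2 - n2 := by linarith
  obtain rfl : y3 = x3 - n3 := by linarith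
  have hn : n1*n3 - n2^2 = 0 := by linear_combination hxy
  have o : x1*n3 + x3*n1 - 2*x2*n2 = 0 := by linear_combination hx + hn - hy
  have po : p1*n3 + p3*n1 - 2*p2*n2 = 0 := by linear_combination hpy - hpx - hy + hx
  have q : p1*p3 - p2^2 = p1*x3 + p3*x1 - 2*p2*x2 := by linear_combination hpx - hx
  have r13 : x3*n1 - x1*n3 = 0 := by
    have : (x3*n1 - x1*n3)^2 = 0 := by
      linear_combination (x1*n3+x3*n1+2*x2*n2) * o - 4 * n1*n3*hx - 4*x2^2*hn
    exact pow_eq_zero_iff two_ne_zero |>.1 this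
  have r12 : x2*n1 - x1*n2 = 0 := by
    have : (x2*n1 - x1*n2)^2 = 0 := by
      linear_combination x1*n1*o - n1^2*hx - x1^2*hn
    exact pow_eq_zero_iff two_ne_zero |>.1 this
  have r32 : x2*n3 - x3*n2 = 0 := by
    have : (x2*n3 - x3*n2)^2 = 0 := by
      linear_combination x3*n3*o - n3^2*hx - x3^2*hn
    exact pow_eq_zero_iff two_ne_zero |>.1 this
  rw [q]
  by_cases h1 : n1 = 0
  · by_cases h3 : n3 = 0
    · exfalso
      have : n2 = 0 := by
        rw [h1] at hn; simpa using hn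
      apply hne
      rw [h1, h3, this]; simp
    · apply (mul_eq_zero.1 (?_ : n3 * _ = 0)).resolve_left h3
      linear_combination x3 * po - p3 * r13 - 2*p2*r32
  · apply (mul_eq_zero.1 (?_ : n1 * _ = 0)).resolve_left h1
    linear_combination x1 * po + p1 * r13 - 2*p2*r12

lemma T (x y p : M2) (sx : x.IsSymm) (sy : y.IsSymm) (sp : p.IsSymm) (hx : x.det = 0) (hy : y.det = 0)
    (hxy : (x-y).det = 0) (hpx : (p - x).det = 0) (hpy : (p-y).det = 0) (hne : x ≠ y) :
    p.det = 0 := by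
  obtain ⟨x1, x2, x3, rfl⟩ := Sm_ex x sx
  obtain ⟨y1, y2, y3, rfl⟩ := Sm_ex y sy
  obtain ⟨p1, p2, p3, rfl⟩ := Sm_ex p sp
  simp only [Sm_sub, Sm_det, ne_eq, Sm_inj] at *
  exact Tcoord _ _ _ _ _ _ _ _ _ hx hy hxy hpx hpy hne

lemma Ncore (Φ : M2 → M2) (h : Pres Φ) (h0 : Φ 0 = 0) (d1 d2 : ℝ) (h1 : d1 ≠ 0) (h2 : d2 ≠ 0)
    (hH : (Φ (Sm d1 0 d2)).det ≠ 0) : ∃ A B : M2, A.IsSymm ∧ B.IsSymm ∧ A.det = 0 ∧ B.det = 0 ∧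
      (Φ A - Φ B).det ≠ 0 := by
  by_contra hcon
  push Not at hcon
  have s0 : (0 : M2).IsSymm := by rw [← Sm_zero]; exact Sm_symm _ _ _
  have hnull : ∀ A : M2, A.IsSymm → A.det = 0 → (Φ A).det = 0 := by
    intro A hA dA
    have := hcon A 0 hA s0 dA (by rw [← Sm_zero, Sm_det]; ring)
    rwa [h0, sub_zero] at this
  have hconst : ∀ P A B : M2, P.IsSymm → A.IsSymm → B.IsSymm → A.det = 0 → B.det = 0 →
      (P - A).det = 0 → (P - B).det = 0 → (Φ P).det ≠ 0 → Φ A = Φ B := by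
    intro P A B hP hA hB dA dB pA pB hg
    by_contra hne
    exact hg (T _ _ _ (h.1 A hA) (h.1 B hB) (h.1 P hP) (hnull A hA dA) (hnull B hB dB)
      (hcon A B hA hB dA dB) (h.weak hP hA pA) (h.weak hP hB pB) hne)
  have sp := Sm_symm d1 0 0
  have sH := Sm_symm d1 0 d2
  have sQ := Sm_symm d1 0 (2*d2)
  have dp : (Sm d1 0 0).det = 0 := by rw [Sm_det]; ring
  have hQ : (Φ (Sm d1 0 (2*d2))).det ≠ 0 := by
    intro hQ
    obtain ⟨e1, e2⟩ := h.2 _ _ sQ sp (by rw [ne_eq, Sm_inj]; simp [h2]) (by rw [Sm_sub, Sm_det]; ring)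
    exact hH (T _ _ _ (h.1 _ sQ) (h.1 _ sp) (h.1 _ sH) hQ (hnull _ sp dp) e2
      (h.weak sH sQ (by rw [Sm_sub, Sm_det]; ring)) (h.weak sH sp (by rw [Sm_sub, Sm_det]; ring)) e1)
  obtain ⟨y, hy0, hy1, hy2⟩ : ∃ y : ℝ, y ≠ 0 ∧ d2 + y^2*d1 ≠ 0 ∧ 2*d2 + y^2*d1 ≠ 0 := by
    by_contra hc
    push Not at hc
    have a1 := hc 1 one_ne_zero
    have a2 := hc 2 two_ne_zero
    by_cases c1 : d2 + 1^2*d1 = 0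
    · have := a2 (fun e => h1 (by linarith))
      exact h1 (by linarith)
    · have b1 := a1 c1
      by_cases c2 : d2 + 2^2*d1 = 0
      · exact h1 (by linarith)
      · have := a2 c2
        exact h1 (by linarith)
  obtain ⟨t, ht⟩ : ∃ t, t = d1*d2/(d2 + y^2*d1) := ⟨_, rfl⟩
  obtain ⟨t', ht'⟩ : ∃ t, t = d1*(2*d2)/(2*d2 + y^2*d1) := ⟨_, rfl⟩
  have ht1 : t * (d2 + y^2*d1) = d1*d2 := by rw [ht, div_mul_cancel₀ _ hy1]
  have ht1' : t' * (2*d2 + y^2*d1) = d1*(2*d2) := by rw [ht', div_mul_cancel₀ _ hy2]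
  have htt : t ≠ t' := by
    rw [ht, ht']; intro e
    rw [div_eq_div_iff hy1 hy2] at e
    have : d1^2 * d2 * y^2 = 0 := by linear_combination -e
    simp_all
  have st : ∀ t, (Sm t (t*y) (t*y^2)).IsSymm := fun t => Sm_symm _ _ _
  have dt : ∀ t, (Sm t (t*y) (t*y^2)).det = 0 := fun t => by rw [Sm_det]; ring
  have e1 := hconst _ _ _ sH sp (st t) dp (dt t) (by rw [Sm_sub, Sm_det]; ring)
    (by rw [Sm_sub, Sm_det]; linear_combination -ht1) hH
  have e2 := hconst _ _ _ sQ sp (st t') dp (dt t') (by rw [Sm_sub, Sm_det]; ring)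
    (by rw [Sm_sub, Sm_det]; linear_combination -ht1') hQ
  exact (h.2 _ _ (st t) (st t') (by rw [ne_eq, Sm_inj]; tauto) (by rw [Sm_sub, Sm_det]; ring)).1
    (e1.symm.trans e2)

lemma N (Φ : M2 → M2) (h : Pres Φ) (h0 : Φ 0 = 0) (H : M2) (sH : H.IsSymm)
    (hH : (Φ H).det ≠ 0) : ∃ A B : M2, A.IsSymm ∧ B.IsSymm ∧ A.det = 0 ∧ B.det = 0 ∧
      (Φ A - Φ B).det ≠ 0 := by
  by_cases dH : H.det = 0
  · have s0 : (0 : M2).IsSymm := by rw [← Sm_zero]; exact Sm_symm _ _ _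
    have := h.weak sH s0 (by rwa [sub_zero])
    rw [h0, sub_zero] at this
    exact absurd this hH
  obtain ⟨R, hR, a, b, rfl⟩ := diag_form H sH
  rw [conj_det, Sm_det] at dH
  have hp := h.conj R 1 1 hR (by simp) one_ne_zero
  simp only [Matrix.one_mul, Matrix.transpose_one, Matrix.mul_one, one_smul] at hp
  obtain ⟨A, B, sA, sB, dA, dB, hd⟩ := Ncore _ hp (by simpa using h0) a b
    (by rintro rfl; simp at dH) (by rintro rfl; simp at dH) hH
  exact ⟨_, _, symm_conj R A sA, symm_conj R B sB, by rw [conj_det, dA, mul_zero],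
    by rw [conj_det, dB, mul_zero], hd⟩

lemma Pres.AP {Φ : M2 → M2} (h : Pres Φ) : AP (fun a b c => Φ (Sm a b c) 0 0)
    (fun a b c => Φ (Sm a b c) 0 1) (fun a b c => Φ (Sm a b c) 1 1) := by
  intro a b c a' b' c' hd hne
  obtain ⟨h1, h2⟩ := h.2 (Sm a b c) (Sm a' b' c') (Sm_symm _ _ _) (Sm_symm _ _ _)
    (by rwa [ne_eq, Sm_inj]) (by rw [Sm_sub, Sm_det]; linarith)
  rw [Sm_of _ (h.1 _ (Sm_symm a b c)), Sm_of _ (h.1 _ (Sm_symm a' b' c'))] at h1 h2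
  rw [ne_eq, Sm_inj] at h1
  rw [Sm_sub, Sm_det] at h2
  exact ⟨by linarith, h1⟩

lemma line1 (x y z a : ℝ) (ha : a ≠ 0) (h : x*z - y^2 = 0) (h' : (x-a)*z - y^2 = 0) :
    y = 0 ∧ z = 0 := by
  have : a * z = 0 := by linear_combination h - h'
  have hz := (mul_eq_zero.1 this).resolve_left ha
  subst hz
  exact ⟨by simpa using h, rfl⟩

lemma Kdiag (Φ : M2 → M2) (h : Pres Φ) (h0 : Φ 0 = 0) (α β γ δ : ℝ) (hγ : γ ≠ 0) (hδ : δ ≠ 0)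
    (hA : Φ (Sm α 0 0) = Sm γ 0 0) (hB : Φ (Sm 0 0 β) = Sm 0 0 δ) :
    ∃ p q, 0 < p * q ∧ ∀ a b, Φ (Sm a 0 b) = Sm (p*a) 0 (q*b) := by
  have s0 : (0 : M2).IsSymm := by rw [← Sm_zero]; exact Sm_symm _ _ _
  have z0 : ∀ A : M2, A.IsSymm → A.det = 0 → (Φ A).det = 0 := by
    intro A hA dA
    have := h.weak hA s0 (by rwa [sub_zero])
    rwa [h0, sub_zero] at this
  obtain ⟨p, q, hpq, hh⟩ := K _ _ _ h.AP (by
      intro a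
      have e1 := z0 _ (Sm_symm a 0 0) (by rw [Sm_det]; ring)
      have e2 := h.weak (Sm_symm a 0 0) (Sm_symm α 0 0) (by rw [Sm_sub, Sm_det]; ring)
      rw [hA] at e2
      obtain ⟨x, y, z, e⟩ := Sm_ex _ (h.1 _ (Sm_symm a 0 0))
      rw [e] at e1 e2 ⊢
      rw [Sm_det] at e1
      rw [Sm_sub, Sm_det] at e2
      have := line1 x y z γ hγ e1 (by linarith)
      simpa [Sm] using this) (by
      intro a
      have e1 := z0 _ (Sm_symm 0 0 a) (by rw [Sm_det]; ring)
      have e2 := h.weak (Sm_symm 0 0 a) (Sm_symm 0 0 β) (by rw [Sm_sub, Sm_det]; ring)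
      rw [hB] at e2
      obtain ⟨x, y, z, e⟩ := Sm_ex _ (h.1 _ (Sm_symm 0 0 a))
      rw [e] at e1 e2 ⊢
      rw [Sm_det] at e1
      rw [Sm_sub, Sm_det] at e2
      have := line1 z y x δ hδ (by linarith) (by linarith)
      simpa [Sm] using this)
  refine ⟨p, q, hpq, fun a b => ?_⟩
  obtain ⟨i, j, k⟩ := hh a b
  rw [Sm_of _ (h.1 _ (Sm_symm a 0 b)), i, j, k]

lemma inv_conj (P A : M2) (hP : P.det ≠ 0) : P⁻¹ * (P * A * Pᵀ) * (P⁻¹)ᵀ = A := by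
  have h1 : P⁻¹ * P = 1 := Matrix.nonsing_inv_mul P hP.isUnit
  have h2 : Pᵀ * (P⁻¹)ᵀ = 1 := by rw [← Matrix.transpose_mul, h1, Matrix.transpose_one]
  calc P⁻¹ * (P * A * Pᵀ) * (P⁻¹)ᵀ = (P⁻¹ * P) * A * (Pᵀ * (P⁻¹)ᵀ) := by
        simp only [Matrix.mul_assoc]
    _ = A := by rw [h1, h2, Matrix.one_mul, Matrix.mul_one]

lemma congr_inv_cancel (P A : M2) (hP : P.det ≠ 0) : P * (P⁻¹ * A * (P⁻¹)ᵀ) * Pᵀ = A := by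
  have h1 : P * P⁻¹ = 1 := Matrix.mul_nonsing_inv P hP.isUnit
  have h2 : (P⁻¹)ᵀ * Pᵀ = 1 := by rw [← Matrix.transpose_mul, h1, Matrix.transpose_one]
  calc P * (P⁻¹ * A * (P⁻¹)ᵀ) * Pᵀ = (P * P⁻¹) * A * ((P⁻¹)ᵀ * Pᵀ) := by
        simp only [Matrix.mul_assoc]
    _ = A := by rw [h1, h2, Matrix.one_mul, Matrix.mul_one]

lemma conj_smul (R A : M2) (c : ℝ) : c • (R * A * Rᵀ) = R * (c • A) * Rᵀ := by
  rw [Matrix.mul_smul, Matrix.smul_mul]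

lemma inv_det_ne_s17 (P : M2) (hP : P.det ≠ 0) : (P⁻¹).det ≠ 0 := by
  rw [Matrix.det_nonsing_inv, Ring.inverse_eq_inv']
  exact inv_ne_zero hP

lemma conj_conj (P Q A : M2) : P * (Q * A * Qᵀ) * Pᵀ = (P * Q) * A * (P*Q)ᵀ := by
  rw [Matrix.transpose_mul]; simp only [Matrix.mul_assoc]

lemma Kfull (Φ : M2 → M2) (h : Pres Φ) (h0 : Φ 0 = 0) (A B : M2) (sA : A.IsSymm) (sB : B.IsSymm)
    (dA : A.det = 0) (dB : B.det = 0) (hd : (Φ A - Φ B).det ≠ 0) :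
    ∃ R1 R2 : M2, R1.det ≠ 0 ∧ R2.det ≠ 0 ∧ ∃ c : ℝ, (c = 1 ∨ c = -1) ∧ ∃ α β,
      A = R1 * Sm α 0 0 * R1ᵀ ∧ B = R1 * Sm 0 0 β * R1ᵀ ∧
      ∀ a b, Φ (R1 * Sm a 0 b * R1ᵀ) = c • (R2 * Sm a 0 b * R2ᵀ) := by
  have s0 : (0 : M2).IsSymm := by rw [← Sm_zero]; exact Sm_symm _ _ _
  have z0 : ∀ A : M2, A.IsSymm → A.det = 0 → (Φ A).det = 0 := by
    intro A hA dA
    have := h.weak hA s0 (by rwa [sub_zero])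
    rwa [h0, sub_zero] at this
  obtain ⟨R1, hR1, α, β, hα, hβ, eA, eB⟩ := normal_form A B sA sB dA dB (fun e => hd (h.weak sA sB e))
  obtain ⟨R, hR, γ, δ, hγ, hδ, eγ, eδ⟩ := normal_form _ _ (h.1 A sA) (h.1 B sB) (z0 A sA dA) (z0 B sB dB) hd
  have hp := h.conj R1 R⁻¹ 1 hR1 (inv_det_ne_s17 R hR) one_ne_zero
  simp only [one_smul] at hp
  obtain ⟨p, q, hpq, hh⟩ := Kdiag _ hp (by simp [h0]) α β γ δ hγ hδ
    (by rw [← eA, eγ, inv_conj R _ hR]) (by rw [← eB, eδ, inv_conj R _ hR])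
  have hh' : ∀ a b, Φ (R1 * Sm a 0 b * R1ᵀ) = R * Sm (p*a) 0 (q*b) * Rᵀ := by
    intro a b
    rw [← hh a b, congr_inv_cancel R _ hR]
  obtain ⟨c, hc, hcp, hcq⟩ : ∃ c : ℝ, (c = 1 ∨ c = -1) ∧ 0 < c * p ∧ 0 < c * q := by
    rcases pos_and_pos_or_neg_and_neg_of_mul_pos hpq with ⟨i, j⟩ | ⟨i, j⟩
    · exact ⟨1, Or.inl rfl, by linarith, by linarith⟩
    · exact ⟨-1, Or.inr rfl, by linarith, by linarith⟩
  have hcc : c * c = 1 := by rcases hc with rfl | rfl <;> norm_num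
  refine ⟨R1, R * !![Real.sqrt (c*p), 0; 0, Real.sqrt (c*q)], hR1, ?_, c, hc, α, β, eA, eB, fun a b => ?_⟩
  · rw [Matrix.det_mul, Matrix.det_fin_two_of]
    have := Real.sqrt_pos.2 hcp
    have := Real.sqrt_pos.2 hcq
    rw [mul_zero, sub_zero]
    positivity
  · rw [hh', ← conj_conj, conj_Sm, Real.sq_sqrt hcp.le, Real.sq_sqrt hcq.le, conj_smul, Sm_smul]
    congr 2
    rw [Sm_inj]
    refine ⟨by linear_combination -p * a * hcc, by ring, by linear_combination -q * b * hcc⟩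

lemma Klin (Φ : M2 → M2) (h : Pres Φ) (h0 : Φ 0 = 0) (A B : M2) (sA : A.IsSymm) (sB : B.IsSymm)
    (dA : A.det = 0) (dB : B.det = 0) (hd : (Φ A - Φ B).det ≠ 0) (a b : ℝ) :
    Φ (a • A + b • B) = a • Φ A + b • Φ B := by
  obtain ⟨R1, R2, h1, h2, c, hc, α, β, rfl, rfl, hh⟩ := Kfull Φ h h0 A B sA sB dA dB hd
  have e : ∀ R : M2, a • (R * Sm α 0 0 * Rᵀ) + b • (R * Sm 0 0 β * Rᵀ) =
      R * Sm (a*α) 0 (b*β) * Rᵀ := by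
    intro R
    rw [conj_smul, conj_smul, ← Matrix.add_mul, ← Matrix.mul_add, Sm_smul, Sm_smul, Sm_add]
    simp
  rw [e, hh, hh, hh, smul_comm a c, smul_comm b c, ← smul_add, e]

lemma fix_all (Φ : M2 → M2) (h : Pres Φ) (hdiag : ∀ a b, Φ (Sm a 0 b) = Sm a 0 b)
    (h111 : Φ (Sm 1 1 1) = Sm 1 1 1) (A : M2) (sA : A.IsSymm) : Φ A = A := by
  have h0 : Φ 0 = 0 := by rw [← Sm_zero, hdiag]
  have dn : ∀ t y, (Sm t (t*y) (t*y^2)).det = 0 := fun t y => by rw [Sm_det]; ring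
  have pm : ∀ t y, t ≠ 0 → y ≠ 0 → ∃ e : ℝ, (e = 1 ∨ e = -1) ∧
      Φ (Sm t (t*y) (t*y^2)) = Sm t (e*(t*y)) (t*y^2) := by
    intro t y ht hy
    obtain ⟨x, w, z, e⟩ := Sm_ex _ (h.1 _ (Sm_symm t (t*y) (t*y^2)))
    have e0 := h.weak (Sm_symm t (t*y) (t*y^2)) (Sm_symm 0 0 0) (by rw [Sm_sub, Sm_det]; ring)
    have e1 := h.weak (Sm_symm t (t*y) (t*y^2)) (Sm_symm (t/2) 0 (-(t*y^2)))
      (by rw [Sm_sub, Sm_det]; ring)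
    have e2 := h.weak (Sm_symm t (t*y) (t*y^2)) (Sm_symm (-t) 0 (t*y^2/2))
      (by rw [Sm_sub, Sm_det]; ring)
    rw [e, hdiag, Sm_sub, Sm_det] at e0 e1 e2
    have f1 : x * (t*y^2) - t/2 * z = t/2 * (t*y^2) := by linear_combination e1 - e0
    have f2 : -x * (t*y^2)/2 + t * z = t * (t*y^2)/2 := by linear_combination e2 - e0
    have hx : x = t := by
      apply mul_right_cancel₀ (mul_ne_zero ht (pow_ne_zero 2 hy))
      linear_combination 4/3 * f1 + 2/3 * f2
    have hz : z = t * y^2 := by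
      apply mul_left_cancel₀ ht
      linear_combination 2/3 * f1 + 4/3 * f2
    subst hx
    rw [hz] at e e0
    have : (w - x*y) * (w + x*y) = 0 := by linear_combination -e0
    rcases mul_eq_zero.1 this with g | g
    · exact ⟨1, Or.inl rfl, by rw [e, Sm_inj]; refine ⟨rfl, by linarith, rfl⟩⟩
    · exact ⟨-1, Or.inr rfl, by rw [e, Sm_inj]; refine ⟨rfl, by linarith, rfl⟩⟩
  have dn1 : ∀ y, (Sm 1 y (y^2)).det = 0 := fun y => by rw [Sm_det]; ring
  -- transfer from `y` to `y'`
  have tr : ∀ y y', y ≠ 0 → y' ≠ 0 → y ≠ y' → y ≠ -y' → Φ (Sm 1 y (y^2)) = Sm 1 y (y^2) →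
      Φ (Sm 1 y' (y'^2)) = Sm 1 y' (y'^2) := by
    intro y y' hy hy' n1 n2 hfix
    obtain ⟨e, he, hh⟩ := pm 1 y' one_ne_zero hy'
    simp only [one_mul] at hh
    have := Klin Φ h h0 _ _ (Sm_symm 1 y (y^2)) (Sm_symm 1 y' (y'^2)) (dn1 y) (dn1 y') (by
      rw [hfix, hh, Sm_sub, Sm_det]
      rcases he with rfl | rfl
      · have : y - y' ≠ 0 := sub_ne_zero.2 n1
        simpa using this
      · have : y + y' ≠ 0 := fun e => n2 (by linarith)
        simpa using this) y' (-y)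
    rw [hfix, hh, Sm_smul, Sm_smul, Sm_smul, Sm_add, Sm_add, show y'*y + -y*y' = 0 by ring, hdiag, Sm_inj] at this
    have h3 := this.2.1
    rcases he with rfl | rfl
    · rw [hh, one_mul]
    · exfalso
      have : y * y' = 0 := by linarith
      exact mul_ne_zero hy hy' this
  have f1 : Φ (Sm 1 1 (1^2)) = Sm 1 1 (1^2) := by simpa using h111
  have f2 := tr 1 2 (by norm_num) (by norm_num) (by norm_num) (by norm_num) f1
  have all1 : ∀ y, y ≠ 0 → Φ (Sm 1 y (y^2)) = Sm 1 y (y^2) := by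
    intro y hy
    by_cases a1 : (1:ℝ) = y
    · rw [← a1]; exact f1
    by_cases a2 : (1:ℝ) = -y
    · refine tr 2 y (by norm_num) hy (fun e => ?_) (fun e => ?_) f2 <;> linarith
    · exact tr 1 y one_ne_zero hy a1 a2 f1
  have null : ∀ A : M2, A.IsSymm → A.det = 0 → Φ A = A := by
    intro A sA dA
    obtain ⟨a, b, c, rfl⟩ := Sm_ex A sA
    rw [Sm_det] at dA
    by_cases hb : b = 0
    · subst hb; exact hdiag a c
    have ha : a ≠ 0 := by rintro rfl; simp at dA; exact hb dA
    obtain ⟨y, rfl⟩ : ∃ y, b = a*y := ⟨b/a, by field_simp⟩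
    have hy : y ≠ 0 := by rintro rfl; simp at hb
    obtain rfl : c = a*y^2 := by
      apply mul_left_cancel₀ ha; linarith
    obtain ⟨e, he, hh⟩ := pm a y ha hy
    have w := h.weak (Sm_symm a (a*y) (a*y^2)) (Sm_symm 1 y (y^2)) (by rw [Sm_sub, Sm_det]; ring)
    rw [all1 y hy, hh, Sm_sub, Sm_det] at w
    rcases he with rfl | rfl
    · rw [hh, one_mul]
    · exfalso
      have : a * y^2 = 0 := by linear_combination -w/4
      exact mul_ne_zero ha (pow_ne_zero 2 hy) this
  by_cases dA : A.det = 0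
  · exact null A sA dA
  obtain ⟨R, hR, α, β, rfl⟩ := diag_form A sA
  have n1 : (R * Sm α 0 0 * Rᵀ).det = 0 := by rw [conj_det, Sm_det]; ring
  have n2 : (R * Sm 0 0 β * Rᵀ).det = 0 := by rw [conj_det, Sm_det]; ring
  have s1 := symm_conj R _ (Sm_symm α 0 0)
  have s2 := symm_conj R _ (Sm_symm 0 0 β)
  have := Klin Φ h h0 _ _ s1 s2 n1 n2 (by
    rw [null _ s1 n1, null _ s2 n2, conj_sub, Sm_sub, conj_det, Sm_det]
    rw [conj_det, Sm_det] at dA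
    intro e; apply dA; linear_combination -e) 1 1
  rw [null _ s1 n1, null _ s2 n2, one_smul, one_smul, ← Matrix.add_mul, ← Matrix.mul_add, Sm_add] at this
  simpa using this

/-- An adjacency preserving map `Φ : S_2 → S_2` with `d(Φ(G), Φ(H)) = 2` for
some `G, H` has the form `Φ(A) = c R A Rᵀ + S` with `c ∈ {−1, 1}`, `R`
invertible and `S ∈ S_2`. -/
theorem form_of_adjacency_preserver_S2
    (Φ : Matrix (Fin 2) (Fin 2) ℝ → Matrix (Fin 2) (Fin 2) ℝ)
    (hΦsym : ∀ A : Matrix (Fin 2) (Fin 2) ℝ, A.IsSymm → (Φ A).IsSymm)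
    (hΦadj : ∀ A B : Matrix (Fin 2) (Fin 2) ℝ, A.IsSymm → B.IsSymm →
      (A - B).rank = 1 → (Φ A - Φ B).rank = 1)
    (h : ∃ G H : Matrix (Fin 2) (Fin 2) ℝ, G.IsSymm ∧ H.IsSymm ∧
      (Φ G - Φ H).rank = 2) :
    ∃ c : ℝ, (c = 1 ∨ c = -1) ∧ ∃ R : Matrix (Fin 2) (Fin 2) ℝ, IsUnit R ∧
      ∃ S : Matrix (Fin 2) (Fin 2) ℝ, S.IsSymm ∧
        ∀ A : Matrix (Fin 2) (Fin 2) ℝ, A.IsSymm →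
          Φ A = c • (R * A * Rᵀ) + S := by
  obtain ⟨H, G, sH, sG, hGH⟩ := h
  have hdet : (Φ H - Φ G).det ≠ 0 := by
    intro hd
    by_cases e : Φ H - Φ G = 0
    · rw [e] at hGH; simp at hGH
    · rw [(rank_one_iff _).2 ⟨e, hd⟩] at hGH; norm_num at hGH
  have hp : Pres (fun A => Φ (A + G) - Φ G) := by
    refine ⟨fun A hA => (hΦsym _ (hA.add sG)).sub (hΦsym _ sG), fun A B hA hB hne hd => ?_⟩
    have := (rank_one_iff _).1 (hΦadj (A + G) (B + G) (hA.add sG) (hB.add sG) (by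
      rw [add_sub_add_right_eq_sub]
      exact (rank_one_iff _).2 ⟨sub_ne_zero.2 hne, hd⟩))
    simp only [sub_sub_sub_cancel_right]
    exact ⟨fun e => this.1 (sub_eq_zero.2 (sub_left_injective e)), this.2⟩
  obtain ⟨Ψ, hΨ⟩ : ∃ Ψ : M2 → M2, Ψ = fun A => Φ (A + G) - Φ G := ⟨_, rfl⟩
  rw [← hΨ] at hp
  have h0 : Ψ 0 = 0 := by rw [hΨ]; simp
  obtain ⟨A, B, sA, sB, dA, dB, hd⟩ := N Ψ hp h0 (H - G) (sH.sub sG) (by rw [hΨ]; simpa using hdet)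
  obtain ⟨R1, R2, hR1, hR2, c, hc, α, β, -, -, hh⟩ := Kfull Ψ hp h0 A B sA sB dA dB hd
  have hcc : c * c = 1 := by rcases hc with rfl | rfl <;> norm_num
  have hc0 : c ≠ 0 := by rintro rfl; simp at hcc
  -- it suffices to know the form up to conjugation
  suffices hs : ∃ R3 : M2, R3.det ≠ 0 ∧ ∀ M : M2, M.IsSymm →
      Ψ (R1 * M * R1ᵀ) = c • (R3 * M * R3ᵀ) by
    obtain ⟨R3, hR3, hs⟩ := hs
    have hRd : (R3 * R1⁻¹).det ≠ 0 := by
      rw [Matrix.det_mul]; exact mul_ne_zero hR3 (inv_det_ne_s17 R1 hR1)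
    have lin : ∀ M : M2, M.IsSymm → Ψ M = c • ((R3 * R1⁻¹) * M * (R3 * R1⁻¹)ᵀ) := by
      intro M hM
      have := hs (R1⁻¹ * M * (R1⁻¹)ᵀ) (symm_conj _ _ hM)
      rw [congr_inv_cancel R1 _ hR1, conj_conj] at this
      exact this
    refine ⟨c, hc, R3 * R1⁻¹, (Matrix.isUnit_iff_isUnit_det _).2 hRd.isUnit,
      Φ G - c • ((R3 * R1⁻¹) * G * (R3 * R1⁻¹)ᵀ), ?_, fun M hM => ?_⟩
    · exact (hΦsym G sG).sub ((symm_conj _ _ sG).smul c)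
    · have := lin (M - G) (hM.sub sG)
      rw [← conj_sub, smul_sub, hΨ] at this
      simp only [sub_add_cancel] at this
      rw [sub_eq_iff_eq_add] at this
      rw [this]; abel
  have step : ∀ R3 : M2, R3.det ≠ 0 → (∀ a b, Ψ (R1 * Sm a 0 b * R1ᵀ) = c • (R3 * Sm a 0 b * R3ᵀ)) →
      Ψ (R1 * Sm 1 1 1 * R1ᵀ) = c • (R3 * Sm 1 1 1 * R3ᵀ) → ∀ M : M2, M.IsSymm →
      Ψ (R1 * M * R1ᵀ) = c • (R3 * M * R3ᵀ) := by
    intro R3 hR3 hd3 h111 M hM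
    have back : ∀ N : M2, c • (R3⁻¹ * (c • (R3 * N * R3ᵀ)) * (R3⁻¹)ᵀ) = N := by
      intro N
      rw [Matrix.mul_smul, Matrix.smul_mul, smul_smul, hcc, one_smul, inv_conj R3 _ hR3]
    have := fix_all _ (hp.conj R1 R3⁻¹ c hR1 (inv_det_ne_s17 R3 hR3) hc0) (fun a b => by
      rw [hd3, back]) (by rw [h111, back]) M hM
    conv_rhs => rw [← this]
    rw [Matrix.mul_smul, Matrix.smul_mul, smul_smul, hcc, one_smul, congr_inv_cancel R3 _ hR3]
  -- the image of the all-ones matrix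
  obtain ⟨x, y, z, hxyz⟩ : ∃ x y z, Ψ (R1 * Sm 1 1 1 * R1ᵀ) = c • (R2 * Sm x y z * R2ᵀ) := by
    obtain ⟨x, y, z, e⟩ := Sm_ex (c • (R2⁻¹ * Ψ (R1 * Sm 1 1 1 * R1ᵀ) * (R2⁻¹)ᵀ))
      ((symm_conj _ _ (hp.1 _ (symm_conj _ _ (Sm_symm 1 1 1)))).smul c)
    refine ⟨x, y, z, ?_⟩
    rw [← e, Matrix.mul_smul, Matrix.smul_mul, smul_smul, hcc, one_smul, congr_inv_cancel R2 _ hR2]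
  have adj : ∀ a b, (1-a)*(1-b) - 1 = 0 → (x-a)*(z-b) - y^2 = 0 := by
    intro a b hab
    have := hp.weak (symm_conj R1 _ (Sm_symm 1 1 1)) (symm_conj R1 _ (Sm_symm a 0 b)) (by
      rw [conj_sub, conj_det, Sm_sub, Sm_det]
      rw [show (1-a)*(1-b) - (1-0)^2 = 0 by linarith, mul_zero])
    rw [hxyz, hh, ← smul_sub, conj_sub, Matrix.det_smul, conj_det, Sm_sub, Sm_det] at this
    simp only [mul_eq_zero, Fintype.card_fin, pow_eq_zero_iff two_ne_zero, hc0, hR2, false_or, sub_zero] at this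
    exact this
  have a1 := adj 0 0 (by norm_num)
  have a2 := adj (1/2) (-1) (by norm_num)
  have a3 := adj (-1) (1/2) (by norm_num)
  have hx : x = 1 := by linarith
  have hz : z = 1 := by linarith
  subst hx; subst hz
  have : (y - 1) * (y + 1) = 0 := by linear_combination -a1
  rcases mul_eq_zero.1 this with e | e
  · obtain rfl : y = 1 := by linarith
    exact ⟨R2, hR2, step R2 hR2 hh hxyz⟩
  · obtain rfl : y = -1 := by linarith
    have hJ : (R2 * !![1, 0; 0, -1]).det ≠ 0 := by
      rw [Matrix.det_mul, Matrix.det_fin_two_of]; simpa using hR2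
    refine ⟨_, hJ, step _ hJ (fun a b => ?_) ?_⟩
    · rw [hh, ← conj_conj, conj_Sm]; simp
    · rw [hxyz, ← conj_conj]
      congr 3
      ext i j; fin_cases i <;> fin_cases j <;> simp [Sm, Matrix.mul_apply, Fin.sum_univ_two]
end

section
/- Let m, n ≥ 3 and let Φ : S_n → S_m be an adjacency preserving map with Φ(0) = 0. Suppose that for every projection P ∈ S_n with rank(P) = n − 1 there exists a rank-one projection Q ∈ S_m such that Φ(P·S_n·P) ⊆ ℝ·Q, where P·S_n·P = {C ∈ S_n : P·C·P = C}. Then Φ is degenerate, i.e., there exist a rank-one matrix B ∈ S_m and a function f : S_n → ℝ such that Φ(A) = f(A)·B for all A ∈ S_n. -/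
open Matrix

lemma rk1 {m : ℕ} (M : Matrix (Fin m) (Fin m) ℝ) (h : M.IsSymm) (hr : M.rank = 1) :
    ∃ (e : ℝ) (r : Fin m → ℝ), e ≠ 0 ∧ r ≠ 0 ∧ M = e • vecMulVec r r := by
  have h1 := hr
  rw [Matrix.rank, finrank_eq_one_iff'] at h1
  obtain ⟨⟨u, hu⟩, hu0, hall⟩ := h1
  have hu0' : u ≠ 0 := fun h => hu0 (by simp [h])
  have hcol : ∀ j, ∃ c : ℝ, ∀ i, M i j = c * u i := by
    intro j
    obtain ⟨c, hc⟩ := hall ⟨M.mulVecLin (Pi.single j 1), LinearMap.mem_range_self _ _⟩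
    refine ⟨c, fun i => ?_⟩
    have := congrFun (congrArg Subtype.val hc) i
    simpa using this.symm
  choose c hc using hcol
  obtain ⟨k, hk⟩ := Function.ne_iff.1 hu0'
  simp only [Pi.zero_apply] at hk
  have hck : ∀ i, c i = c k / u k * u i := by
    intro i
    have h2 := h.apply i k
    rw [hc, hc] at h2
    field_simp
    linarith
  have hM : M = (c k / u k) • vecMulVec u u := by
    ext i j
    rw [hc, hck j]; simp [vecMulVec_apply]; ring
  refine ⟨_, u, ?_, hu0', hM⟩
  intro h0
  rw [h0, zero_smul] at hM
  rw [hM] at hr; simp at hr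

lemma rk1' {n : ℕ} (r : Fin n → ℝ) (hr : r ≠ 0) {e : ℝ} (he : e ≠ 0) :
    (e • vecMulVec r r).rank = 1 := by
  apply le_antisymm
  · rw [← smul_vecMulVec]; exact rank_vecMulVec_le _ _
  · rw [Nat.one_le_iff_ne_zero]
    intro h
    rw [Matrix.rank, Submodule.finrank_eq_zero, LinearMap.range_eq_bot] at h
    replace h : e • vecMulVec r r = 0 := by
      ext i j
      have := congrFun (LinearMap.congr_fun h (Pi.single j 1)) i
      simpa using this
    obtain ⟨k, hk⟩ := Function.ne_iff.1 hr
    have := congrFun (congrFun h k) k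
    simp [vecMulVec_apply, he] at this
    exact hk this

lemma uniq {m : ℕ} (M Q : Matrix (Fin m) (Fin m) ℝ) (hM : M.IsSymm) (hQ : Q.IsSymm)
    (hQr : Q.rank = 1) (hbad : ∀ t : ℝ, M ≠ t • Q) (s s' : ℝ)
    (h : (M - s • Q).rank = 1) (h' : (M - s' • Q).rank = 1) : s = s' := by
  by_contra hne
  have hs : ∀ t : ℝ, (M - t • Q).IsSymm := fun t => hM.sub (hQ.smul t)
  obtain ⟨q0, q, hq0, hq, hQe⟩ := rk1 Q hQ hQr
  obtain ⟨e, r, he, hr, h1⟩ := rk1 _ (hs s) h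
  obtain ⟨e', r', he', hr', h2⟩ := rk1 _ (hs s') h'
  have key : ∀ i j, e * r i * r j + (s - s') * q0 * q i * q j = e' * r' i * r' j := by
    intro i j
    have a := congrFun (congrFun h1 i) j
    have b := congrFun (congrFun h2 i) j
    have c := congrFun (congrFun hQe i) j
    simp [vecMulVec_apply] at a b c
    rw [c] at a b
    linarith
  obtain ⟨k, hk⟩ := Function.ne_iff.1 hq
  simp only [Pi.zero_apply] at hk
  have par : ∀ i, r i = r k / q k * q i := by
    intro i
    have : e * (s - s') * q0 * (r i * q k - r k * q i) ^ 2 = 0 := by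
      have a := key i i
      have b := key i k
      have c := key k k
      have : (e' * r' i * r' i) * (e' * r' k * r' k) = (e' * r' i * r' k)^2 := by ring
      rw [← a, ← b, ← c] at this
      linarith
    have hz : r i * q k - r k * q i = 0 := by
      simpa [he, hq0, sub_ne_zero.2 hne] using this
    field_simp; linarith
  apply hbad (s + e * (r k / q k)^2 / q0)
  have : M = s • Q + e • vecMulVec r r := by rw [← h1]; abel
  rw [this, add_smul]; congr 1
  rw [hQe]
  ext i j
  simp only [Matrix.smul_apply, vecMulVec_apply, smul_eq_mul]
  rw [par i, par j]; field_simp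

lemma corner {n : ℕ} (hn : 1 ≤ n) (z : Fin n → ℝ) (hz : z ≠ 0) :
    ∃ P : Matrix (Fin n) (Fin n) ℝ, P.IsSymm ∧ P * P = P ∧ P.rank = n - 1 ∧
      ∀ C : Matrix (Fin n) (Fin n) ℝ, C.IsSymm → C *ᵥ z = 0 → P * C * P = C := by
  have hd : z ⬝ᵥ z ≠ 0 := by simpa using hz
  set W : Matrix (Fin n) (Fin n) ℝ := (z ⬝ᵥ z)⁻¹ • vecMulVec z z with hW
  have hWs : W.IsSymm := by
    ext i j; simp [hW, vecMulVec_apply, mul_comm]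
  have hWW : W * W = W := by
    rw [hW, Matrix.smul_mul, Matrix.mul_smul, vecMulVec_mul_vecMulVec]
    ext i j
    simp only [Matrix.smul_apply, smul_eq_mul, vecMulVec_apply, Pi.smul_apply, MulOpposite.smul_eq_mul_unop, MulOpposite.unop_op]
    field_simp
  have hWr : W.rank = 1 := rk1' z hz (inv_ne_zero hd)
  have hWz : W *ᵥ z = z := by
    ext i
    simp [hW, smul_mulVec, vecMulVec_mulVec]
    field_simp
  refine ⟨1 - W, by simpa using (isSymm_one.sub hWs), by simp [sub_mul, mul_sub, hWW], ?_, ?_⟩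
  · have h1 : (1 - W).rank + W.rank ≤ n := by
      simpa using rank_add_rank_le_card_of_mul_eq_zero (A := 1 - W) (B := W) (by simp [sub_mul, hWW])
    have h2 := LinearMap.finrank_range_add_finrank_ker (1 - W).mulVecLin
    rw [Module.finrank_fin_fun] at h2
    change (1 - W).rank + _ = n at h2
    have h3 : Module.finrank ℝ (LinearMap.ker (1 - W).mulVecLin) ≤ W.rank := by
      apply Submodule.finrank_mono
      intro v hv
      rw [LinearMap.mem_ker, mulVecLin_apply, sub_mulVec, one_mulVec, sub_eq_zero] at hv
      exact ⟨v, hv.symm⟩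
    omega
  · intro C hC hCz
    have h1 : C * W = 0 := by
      simp [hW, mul_vecMulVec, hCz]
    have h2 : W * C = 0 := by
      have := congrArg transpose h1
      rwa [transpose_mul, hWs.eq, hC.eq, transpose_zero] at this
    simp [sub_mul, mul_sub, h1, h2]

lemma perp {n : ℕ} (hn : 3 ≤ n) (x y : Fin n → ℝ) : ∃ z : Fin n → ℝ, z ≠ 0 ∧ x ⬝ᵥ z = 0 ∧ y ⬝ᵥ z = 0 := by
  have h := LinearMap.ker_ne_bot_of_finrank_lt (f := (Matrix.of ![x, y]).mulVecLin)
    (by simp; omega)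
  obtain ⟨z, hz, hz0⟩ := Submodule.exists_mem_ne_zero_of_ne_bot h
  rw [LinearMap.mem_ker, mulVecLin_apply] at hz
  exact ⟨z, hz0, by simpa [mulVec] using congrFun hz 0, by simpa [mulVec] using congrFun hz 1⟩

theorem degenerate_criterion (n m : ℕ) (hn : 3 ≤ n) (hm : 3 ≤ m)
    (Φ : Matrix (Fin n) (Fin n) ℝ → Matrix (Fin m) (Fin m) ℝ)
    (hΦsym : ∀ A : Matrix (Fin n) (Fin n) ℝ, A.IsSymm → (Φ A).IsSymm)
    (hΦadj : ∀ A B : Matrix (Fin n) (Fin n) ℝ, A.IsSymm → B.IsSymm →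
      (A - B).rank = 1 → (Φ A - Φ B).rank = 1)
    (hΦ0 : Φ 0 = 0)
    (hcorner : ∀ P : Matrix (Fin n) (Fin n) ℝ, P.IsSymm → P * P = P →
      P.rank = n - 1 →
      ∃ Q : Matrix (Fin m) (Fin m) ℝ, Q.IsSymm ∧ Q * Q = Q ∧ Q.rank = 1 ∧
        ∀ C : Matrix (Fin n) (Fin n) ℝ, C.IsSymm → P * C * P = C →
          ∃ t : ℝ, Φ C = t • Q) :
    ∃ B : Matrix (Fin m) (Fin m) ℝ, B.IsSymm ∧ B.rank = 1 ∧
      ∃ f : Matrix (Fin n) (Fin n) ℝ → ℝ,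
        ∀ A : Matrix (Fin n) (Fin n) ℝ, A.IsSymm → Φ A = f A • B := by
  have hc : ∀ z : Fin n → ℝ, z ≠ 0 → ∃ Q : Matrix (Fin m) (Fin m) ℝ,
      ∀ C : Matrix (Fin n) (Fin n) ℝ, C.IsSymm → C *ᵥ z = 0 → ∃ t : ℝ, Φ C = t • Q := by
    intro z hz
    obtain ⟨P, h1, h2, h3, h4⟩ := corner (by omega) z hz
    obtain ⟨Q, -, -, -, hQ⟩ := hcorner P h1 h2 h3
    exact ⟨Q, fun C hC hz => hQ C hC (h4 C hC hz)⟩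
  have vs : ∀ (e : ℝ) (x : Fin n → ℝ), (e • vecMulVec x x).IsSymm := by
    intro e x; ext i j; simp [vecMulVec_apply, mul_comm]
  have vr : ∀ x : Fin n → ℝ, x ≠ 0 → (Φ ((1:ℝ) • vecMulVec x x)).rank = 1 := by
    intro x hx
    have := hΦadj _ 0 (vs 1 x) isSymm_zero (by rw [sub_zero]; exact rk1' x hx one_ne_zero)
    rwa [hΦ0, sub_zero] at this
  let x0 : Fin n → ℝ := Pi.single ⟨0, by omega⟩ 1
  have hx0 : x0 ≠ 0 := by simp [x0]
  set B := Φ ((1:ℝ) • vecMulVec x0 x0) with hB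
  have hBs : B.IsSymm := hΦsym _ (vs 1 x0)
  have hBr : B.rank = 1 := vr x0 hx0
  have two : ∀ (Q X Y : Matrix (Fin m) (Fin m) ℝ), X.rank = 1 → (∃ t : ℝ, X = t • Q) →
      (∃ t : ℝ, Y = t • Q) → ∃ t : ℝ, Y = t • X := by
    rintro Q X Y hX ⟨t, rfl⟩ ⟨s, rfl⟩
    have ht : t ≠ 0 := by rintro rfl; simp at hX
    exact ⟨s / t, by rw [smul_smul]; congr 1; field_simp⟩
  have vz : ∀ x z : Fin n → ℝ, x ⬝ᵥ z = 0 → ((1:ℝ) • vecMulVec x x) *ᵥ z = 0 := by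
    intro x z h; simp [vecMulVec_mulVec, h]
  have sing : ∀ (C : Matrix (Fin n) (Fin n) ℝ) (z : Fin n → ℝ), C.IsSymm → z ≠ 0 →
      C *ᵥ z = 0 → ∃ t : ℝ, Φ C = t • B := by
    intro C z hC hz hCz
    obtain ⟨y, hy, hyz, -⟩ := perp hn z z
    rw [dotProduct_comm] at hyz
    obtain ⟨w, hw, hw1, hw2⟩ := perp hn x0 y
    obtain ⟨Q, hQ⟩ := hc z hz
    obtain ⟨Q', hQ'⟩ := hc w hw
    obtain ⟨t, ht⟩ := two Q _ _ (vr y hy) (hQ _ (vs 1 y) (vz _ _ hyz)) (hQ C hC hCz)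
    obtain ⟨s, hs⟩ := two Q' _ _ (vr x0 hx0) (hQ' _ (vs 1 x0) (vz _ _ hw1))
      (hQ' _ (vs 1 y) (vz _ _ hw2))
    exact ⟨t * s, by rw [ht, hs, smul_smul]⟩
  suffices H : ∀ A : Matrix (Fin n) (Fin n) ℝ, A.IsSymm → ∃ t : ℝ, Φ A = t • B by
    refine ⟨B, hBs, hBr, fun A => if h : A.IsSymm then (H A h).choose else 0, fun A hA => ?_⟩
    simp only [dif_pos hA]
    exact (H A hA).choose_spec
  intro A hA
  by_contra! hbad
  have hAH : A.IsHermitian := by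
    rw [IsHermitian, conjTranspose_eq_transpose_of_trivial]; exact hA
  let i1 : Fin n := ⟨0, by omega⟩
  let i2 : Fin n := ⟨1, by omega⟩
  obtain ⟨v1, v2, d1, d2, n1, n2, h12, e1, e2⟩ : ∃ (v1 v2 : Fin n → ℝ) (d1 d2 : ℝ),
      v1 ⬝ᵥ v1 = 1 ∧ v2 ⬝ᵥ v2 = 1 ∧ v2 ⬝ᵥ v1 = 0 ∧ A *ᵥ v1 = d1 • v1 ∧ A *ᵥ v2 = d2 • v2 := by
    have ho := (orthonormal_iff_ite.1 hAH.eigenvectorBasis.orthonormal)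
    refine ⟨(hAH.eigenvectorBasis i1).ofLp, (hAH.eigenvectorBasis i2).ofLp, hAH.eigenvalues i1,
      hAH.eigenvalues i2, ?_, ?_, ?_, hAH.mulVec_eigenvectorBasis i1,
      hAH.mulVec_eigenvectorBasis i2⟩
    · have := ho i1 i1
      rw [EuclideanSpace.inner_eq_star_dotProduct] at this
      simpa [i1, i2] using this
    · have := ho i2 i2
      rw [EuclideanSpace.inner_eq_star_dotProduct] at this
      simpa [i1, i2] using this
    · have := ho i1 i2
      rw [EuclideanSpace.inner_eq_star_dotProduct] at this
      simpa [i1, i2] using this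
  have hv1 : v1 ≠ 0 := by rintro rfl; simp at n1
  have hv2 : v2 ≠ 0 := by rintro rfl; simp at n2
  have hd1 : d1 ≠ 0 := by
    rintro rfl
    obtain ⟨t, ht⟩ := sing A v1 hA hv1 (by simpa using e1)
    exact hbad t ht
  have hd2 : d2 ≠ 0 := by
    rintro rfl
    obtain ⟨t, ht⟩ := sing A v2 hA hv2 (by simpa using e2)
    exact hbad t ht
  set R1 := d1 • vecMulVec v1 v1 with hR1
  set R2 := d2 • vecMulVec v2 v2 with hR2
  have r1 : R1.rank = 1 := rk1' v1 hv1 hd1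
  have r2 : R2.rank = 1 := rk1' v2 hv2 hd2
  have s1 : R1.IsSymm := vs _ _
  have s2 : R2.IsSymm := vs _ _
  have z11 : R1 *ᵥ v1 = d1 • v1 := by simp [hR1, smul_mulVec, vecMulVec_mulVec, n1]
  have z22 : R2 *ᵥ v2 = d2 • v2 := by simp [hR2, smul_mulVec, vecMulVec_mulVec, n2]
  have z21 : R2 *ᵥ v1 = 0 := by simp [hR2, smul_mulVec, vecMulVec_mulVec, h12]
  obtain ⟨t1, ht1⟩ := sing (A - R1) v1 (hA.sub s1) hv1 (by simp [sub_mulVec, e1, z11])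
  obtain ⟨t2, ht2⟩ := sing (A - R2) v2 (hA.sub s2) hv2 (by simp [sub_mulVec, e2, z22])
  obtain ⟨t3, ht3⟩ := sing (A + R2 - R1) v1 ((hA.add s2).sub s1) hv1
    (by simp [sub_mulVec, add_mulVec, e1, z11, z21])
  have a1 := hΦadj A (A - R1) hA (hA.sub s1) (by simpa using r1)
  have a2 := hΦadj A (A - R2) hA (hA.sub s2) (by simpa using r2)
  rw [ht1] at a1
  rw [ht2] at a2
  have h12t := uniq _ _ (hΦsym A hA) hBs hBr hbad _ _ a1 a2
  have a3 := hΦadj (A + R2) A (hA.add s2) hA (by simpa using r2)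
  have a3' := hΦadj A (A + R2) hA (hA.add s2) (by
    have := rk1' v2 hv2 (neg_ne_zero.2 hd2)
    simpa [hR2] using this)
  have a4 := hΦadj (A + R2) (A - R2) (hA.add s2) (hA.sub s2) (by
    have := rk1' v2 hv2 (show 2 * d2 ≠ 0 by simpa using hd2)
    rw [show A + R2 - (A - R2) = (2 * d2) • vecMulVec v2 v2 by
      rw [mul_smul, ← hR2, two_smul]; abel]
    exact this)
  have a5 := hΦadj (A + R2) (A + R2 - R1) (hA.add s2) ((hA.add s2).sub s1) (by simpa using r1)
  have a6 := hΦadj (A + R2 - R1) (A - R1) ((hA.add s2).sub s1) (hA.sub s1) (by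
    rw [show A + R2 - R1 - (A - R1) = R2 by abel]; exact r2)
  rw [ht2] at a4
  rw [ht3] at a5
  have bad' : ∀ t : ℝ, Φ (A + R2) ≠ t • B := by
    intro t ht
    rw [ht] at a3' a4
    have := uniq _ _ (hΦsym A hA) hBs hBr hbad _ _ a2 a3'
    rw [this] at a4
    simp at a4
  have h23 := uniq _ _ (hΦsym _ (hA.add s2)) hBs hBr bad' _ _ a4 a5
  rw [ht3, ht1, h12t, h23] at a6
  simp at a6
end
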